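/- arXiv:math/0506365 — 11 statements merged into one kernel-verified Lean document; each statement's English description precedes it below -/
import Mathlib

section
/- Every scalar 2-cocycle on the Lie algebra 𝒢_{n,p}(𝕂) is a coboundary: if ω is an alternating bilinear form on 𝒢_{n,p}(𝕂) satisfying ω([a,b],c) + ω([b,c],a) + ω([c,a],b) = 0 for all a, b, c ∈ 𝒢_{n,p}(𝕂), then there exists a linear form β on 𝒢_{n,p}(𝕂) such that ω(a,b) = β([a,b]) for all a, b. In other words H²(𝒢_{n,p}(𝕂), 𝕂) = 0, so every left-invariant symplectic form on G_{n,p}(𝕂) is exact. -/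
open Matrix

section helpers
variable {𝕂 : Type} [RCLike 𝕂] {n : ℕ}

lemma mul_single_exp (w : Matrix (Fin n) (Fin n) 𝕂) (i j : Fin n) :
    w * Matrix.single i j 1 = ∑ l, w l i • Matrix.single l j (1 : 𝕂) := by
  ext a b
  simp [Matrix.mul_apply, Matrix.sum_apply, Matrix.single_apply, ite_and]

lemma single_mul_exp (w : Matrix (Fin n) (Fin n) 𝕂) (i j : Fin n) :
    Matrix.single i j 1 * w = ∑ l, w j l • Matrix.single i l (1 : 𝕂) := by
  ext a b
  simp [Matrix.mul_apply, Matrix.sum_apply, Matrix.single_apply, ite_and]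

lemma cas1 (B : Matrix (Fin n) (Fin n) 𝕂 →ₗ[𝕂] Matrix (Fin n) (Fin n) 𝕂 →ₗ[𝕂] 𝕂)
    (w v : Matrix (Fin n) (Fin n) 𝕂) :
    ∑ i, ∑ j, B (w * Matrix.single i j 1) (Matrix.single j i 1 * v)
      = ∑ i, ∑ j, B (Matrix.single i j 1) (Matrix.single j i 1 * w * v) := by
  simp only [mul_single_exp w, single_mul_exp w, Finset.sum_mul, map_sum, map_smul,
    LinearMap.sum_apply, LinearMap.smul_apply, Matrix.smul_mul]
  rw [Finset.sum_comm, Finset.sum_comm (s := Finset.univ (α := Fin n))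
    (f := fun i j => ∑ l, w i l • B (Matrix.single i j 1) (Matrix.single j l 1 * v))]
  exact Finset.sum_congr rfl fun j _ => Finset.sum_comm

lemma cas2 (B : Matrix (Fin n) (Fin n) 𝕂 →ₗ[𝕂] Matrix (Fin n) (Fin n) 𝕂 →ₗ[𝕂] 𝕂)
    (w v : Matrix (Fin n) (Fin n) 𝕂) :
    ∑ i, ∑ j, B (Matrix.single i j 1 * w) (Matrix.single j i 1 * v)
      = ∑ i, ∑ j, B (Matrix.single i j 1) (w * Matrix.single j i 1 * v) := by
  simp only [mul_single_exp w, single_mul_exp w, Finset.sum_mul, map_sum, map_smul,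
    LinearMap.sum_apply, LinearMap.smul_apply, Matrix.smul_mul]
  exact Finset.sum_congr rfl fun j _ => Finset.sum_comm

lemma cas3 (v : Matrix (Fin n) (Fin n) 𝕂) :
    ∑ i : Fin n, ∑ j : Fin n, (Matrix.single i j 1 * (Matrix.single j i 1 * v)
      - Matrix.single j i 1 * v * Matrix.single i j (1 : 𝕂))
      = (n : 𝕂) • v - v.trace • 1 := by
  have h1 : ∑ i : Fin n, Matrix.single i i (1 : 𝕂) = 1 := by
    ext a b
    simp [Matrix.sum_apply, Matrix.single_apply, Matrix.one_apply, ite_and]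
  have h2 : ∀ i j : Fin n, Matrix.single j i 1 * v * Matrix.single i j (1 : 𝕂)
      = v i i • Matrix.single j j 1 := by
    intro i j
    ext a b
    simp [Matrix.single_mul_mul_single, Matrix.single_apply]
  simp only [← Matrix.mul_assoc, Matrix.single_mul_single_same, h2, Finset.sum_sub_distrib,
    ← Finset.smul_sum, h1, ← Finset.sum_smul, mul_one, ← Finset.sum_mul, Finset.sum_const,
    Finset.card_univ, Fintype.card_fin, one_mul, Matrix.smul_mul]
  simp [Matrix.trace, ← Nat.cast_smul_eq_nsmul 𝕂]

lemma gl_coc (hn : n ≠ 0)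
    (B : Matrix (Fin n) (Fin n) 𝕂 →ₗ[𝕂] Matrix (Fin n) (Fin n) 𝕂 →ₗ[𝕂] 𝕂)
    (hs : ∀ u v, B u v = - B v u) (h1 : ∀ v, B 1 v = 0)
    (hc : ∀ a b c, B (a * b - b * a) c + B (b * c - c * b) a + B (c * a - a * c) b = 0) :
    ∃ γ : Matrix (Fin n) (Fin n) 𝕂 →ₗ[𝕂] 𝕂, ∀ u v, B u v = γ (u * v - v * u) := by
  have hn' : (n : 𝕂) ≠ 0 := by exact_mod_cast hn
  refine ⟨(n : 𝕂)⁻¹ • ∑ i, ∑ j, (B (Matrix.single i j 1)).comp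
    (LinearMap.mulLeft 𝕂 (Matrix.single j i 1)), fun u v => ?_⟩
  have key : ∑ i : Fin n, ∑ j : Fin n, (B (u * Matrix.single i j 1 - Matrix.single i j 1 * u)
      (Matrix.single j i 1 * v)
      + B (Matrix.single i j 1 * (Matrix.single j i 1 * v)
        - Matrix.single j i 1 * v * Matrix.single i j 1) u
      + B (Matrix.single j i 1 * v * u - u * (Matrix.single j i 1 * v))
        (Matrix.single i j 1)) = 0 :=
    Finset.sum_eq_zero fun i _ => Finset.sum_eq_zero fun j _ => hc _ _ _
  have h3 := congrArg (fun m => B m u) (cas3 v)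
  simp only [map_sum, LinearMap.sum_apply] at h3
  simp only [Finset.sum_add_distrib] at key
  rw [h3] at key
  simp only [map_sub, LinearMap.sub_apply, Finset.sum_sub_distrib, cas1, cas2, map_smul,
    LinearMap.smul_apply, h1, hs _ (Matrix.single _ _ 1), ← Matrix.mul_assoc,
    Finset.sum_neg_distrib, hs v u] at key
  simp only [LinearMap.smul_apply, LinearMap.sum_apply, LinearMap.comp_apply,
    LinearMap.mulLeft_apply, mul_sub, map_sub, Finset.sum_sub_distrib, ← Matrix.mul_assoc]
  simp only [smul_eq_mul]
  rw [eq_comm, ← mul_sub, inv_mul_eq_iff_eq_mul₀ hn']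
  simp only [smul_eq_mul] at key
  linear_combination key

end helpers

/-- Every scalar 2-cocycle on the Lie algebra 𝒢_{n,p}(𝕂) is a coboundary:
`H²(𝒢_{n,p}(𝕂), 𝕂) = 0`.  Here `𝒢_{n,p}(𝕂) = M_{n,p}(𝕂) × gl(n,𝕂)` with bracket
`[(x,u),(y,v)] = (u·y − v·x, u·v − v·u)`. -/
theorem stmt0 (𝕂 : Type) [RCLike 𝕂] (p k n : ℕ) (hp : 1 ≤ p) (hk : 1 ≤ k)
    (hn : n = k * p)
    (ω : (Matrix (Fin n) (Fin p) 𝕂 × Matrix (Fin n) (Fin n) 𝕂) →ₗ[𝕂]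
         (Matrix (Fin n) (Fin p) 𝕂 × Matrix (Fin n) (Fin n) 𝕂) →ₗ[𝕂] 𝕂)
    (halt : ∀ a, ω a a = 0)
    (hcocycle : ∀ a b c : Matrix (Fin n) (Fin p) 𝕂 × Matrix (Fin n) (Fin n) 𝕂,
      ω (a.2 * b.1 - b.2 * a.1, a.2 * b.2 - b.2 * a.2) c
      + ω (b.2 * c.1 - c.2 * b.1, b.2 * c.2 - c.2 * b.2) a
      + ω (c.2 * a.1 - a.2 * c.1, c.2 * a.2 - a.2 * c.2) b = 0) :
    ∃ β : (Matrix (Fin n) (Fin p) 𝕂 × Matrix (Fin n) (Fin n) 𝕂) →ₗ[𝕂] 𝕂,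
      ∀ a b : Matrix (Fin n) (Fin p) 𝕂 × Matrix (Fin n) (Fin n) 𝕂,
        ω a b = β (a.2 * b.1 - b.2 * a.1, a.2 * b.2 - b.2 * a.2) := by
  have hn0 : n ≠ 0 := by
    rw [hn]; exact Nat.mul_ne_zero (by omega) (by omega)
  have hn' : (n : 𝕂) ≠ 0 := by exact_mod_cast hn0
  have hs : ∀ a b, ω a b = - ω b a := by
    intro a b
    have h := halt (a + b)
    simp only [map_add, LinearMap.add_apply, halt] at h
    linear_combination h
  have hh : ∀ b c : Matrix (Fin n) (Fin p) 𝕂 × Matrix (Fin n) (Fin n) 𝕂,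
      ω (b.1, 0) c - ω (c.1, 0) b
        = ω (0, 1) (b.2 * c.1 - c.2 * b.1, b.2 * c.2 - c.2 * b.2) := by
    intro b c
    have h := hcocycle (0, 1) b c
    have e : ((0 - c.1, 0) : Matrix (Fin n) (Fin p) 𝕂 × Matrix (Fin n) (Fin n) 𝕂)
        = -(c.1, 0) := by simp
    simp only [Matrix.one_mul, Matrix.mul_one, Matrix.mul_zero, sub_zero, sub_self, e,
      map_neg, LinearMap.neg_apply] at h
    rw [hs (0, 1)]
    linear_combination h
  have hxx : ∀ x y : Matrix (Fin n) (Fin p) 𝕂, ω (x, 0) (y, 0) = 0 := by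
    intro x y
    have h := hh (x, 0) (y, 0)
    have e : ((0, 0) : Matrix (Fin n) (Fin p) 𝕂 × Matrix (Fin n) (Fin n) 𝕂) = 0 := rfl
    simp only [Matrix.zero_mul, sub_zero, e, map_zero] at h
    rw [hs (y, 0)] at h
    linear_combination h / 2
  have hxv : ∀ (x : Matrix (Fin n) (Fin p) 𝕂) v, ω (x, 0) (0, v) = - ω (0, 1) (v * x, 0) := by
    intro x v
    have h := hh (x, 0) (0, v)
    have e : ((0, 0) : Matrix (Fin n) (Fin p) 𝕂 × Matrix (Fin n) (Fin n) 𝕂) = 0 := rfl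
    have e2 : ((-(v * x), 0) : Matrix (Fin n) (Fin p) 𝕂 × Matrix (Fin n) (Fin n) 𝕂)
      = - (v * x, 0) := by simp
    simp only [Matrix.zero_mul, Matrix.mul_zero, sub_zero, zero_sub, neg_zero, e, e2, map_zero,
      LinearMap.zero_apply, map_neg] at h
    exact h
  let ι := LinearMap.inr 𝕂 (Matrix (Fin n) (Fin p) 𝕂) (Matrix (Fin n) (Fin n) 𝕂)
  let B := ω.compl₁₂ ι ι
  have hB : ∀ u v, B u v = ω (0, u) (0, v) := fun u v => rfl
  have hbr : ∀ u v, B 1 (u * v - v * u) = 0 := by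
    intro u v
    have h := hh (0, u) (0, v)
    have e : ((0, 0) : Matrix (Fin n) (Fin p) 𝕂 × Matrix (Fin n) (Fin n) 𝕂) = 0 := rfl
    simp only [Matrix.mul_zero, sub_zero, e, map_zero, LinearMap.zero_apply] at h
    exact h.symm
  have hB1 : ∀ v, B 1 v = 0 := by
    intro v
    have h := congrArg (B 1) (cas3 v)
    simp only [map_sum, hbr, Finset.sum_const_zero] at h
    have h11 : B 1 1 = 0 := halt _
    simp only [map_sub, map_smul, h11, mul_zero, sub_zero, smul_eq_mul] at h
    exact (mul_eq_zero.mp h.symm).resolve_left hn'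
  obtain ⟨γ, hγ⟩ := gl_coc hn0 B (fun u v => hs _ _) hB1 (by
    intro a b c
    have h := hcocycle (0, a) (0, b) (0, c)
    simp only [Matrix.mul_zero, sub_zero] at h
    exact h)
  refine ⟨((ω (0, 1)).comp (LinearMap.inl 𝕂 _ _)).coprod γ, ?_⟩
  rintro ⟨x, u⟩ ⟨y, v⟩
  have e1 : ((x, u) : Matrix (Fin n) (Fin p) 𝕂 × Matrix (Fin n) (Fin n) 𝕂)
    = (x, 0) + (0, u) := by simp
  have e2 : ((y, v) : Matrix (Fin n) (Fin p) 𝕂 × Matrix (Fin n) (Fin n) 𝕂)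
    = (y, 0) + (0, v) := by simp
  have e3 : ((u * y - v * x, 0) : Matrix (Fin n) (Fin p) 𝕂 × Matrix (Fin n) (Fin n) 𝕂)
    = (u * y, 0) - (v * x, 0) := by simp
  have h4 := hγ u v
  rw [hB] at h4
  rw [LinearMap.coprod_apply, LinearMap.comp_apply, LinearMap.inl_apply, ← h4]
  simp only [e3]
  rw [e1, e2]
  simp only [map_add, map_sub, LinearMap.add_apply, hxx, hxv, hs (0, u) (y, 0)]
  ring
end

section
/- The coadjoint action of G_{n,p}(𝕂) is given by (X,U)·(H,N) = (H·U⁻¹, U·N·U⁻¹ + X·H·U⁻¹): for all (X,U) ∈ G_{n,p}(𝕂), all (H,N) ∈ M_{p,n}(𝕂) × gl(n,𝕂) and all (y,v) ∈ 𝒢_{n,p}(𝕂), one has α_{(H·U⁻¹, U·N·U⁻¹ + X·H·U⁻¹)}(y,v) = α_{(H,N)}(Ad_{(X,U)⁻¹}(y,v)), where Ad_{(X,U)}(y,v) = (U·y − U·v·U⁻¹·X, U·v·U⁻¹) is the adjoint action of G_{n,p}(𝕂) on 𝒢_{n,p}(𝕂) (the differential at the identity of conjugation by (X,U)). -/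
open Matrix

/-- The coadjoint action of `G_{n,p}(𝕂)` is given by
`(X,U)·(H,N) = (H·U⁻¹, U·N·U⁻¹ + X·H·U⁻¹)`: evaluating the functional
`α_{(H·U⁻¹, U·N·U⁻¹ + X·H·U⁻¹)}` at `(y,v)` agrees with `α_{(H,N)}(Ad_{(X,U)⁻¹}(y,v))`,
where `Ad_{(X,U)}(y,v) = (U·y − U·v·U⁻¹·X, U·v·U⁻¹)` and `(X,U)⁻¹ = (−U⁻¹·X, U⁻¹)`
in the semidirect product, and `α_{(H,M)}(y,v) = tr(y·H) + tr(M·v)`. -/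
theorem stmt1 (𝕂 : Type) [RCLike 𝕂] (p k n : ℕ) (hp : 1 ≤ p) (hk : 1 ≤ k)
    (hn : n = k * p)
    (X : Matrix (Fin n) (Fin p) 𝕂) (U : GL (Fin n) 𝕂)
    (H : Matrix (Fin p) (Fin n) 𝕂) (N : Matrix (Fin n) (Fin n) 𝕂)
    (y : Matrix (Fin n) (Fin p) 𝕂) (v : Matrix (Fin n) (Fin n) 𝕂)
    (Ad : (Matrix (Fin n) (Fin p) 𝕂 × GL (Fin n) 𝕂) →
      (Matrix (Fin n) (Fin p) 𝕂 × Matrix (Fin n) (Fin n) 𝕂) →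
      (Matrix (Fin n) (Fin p) 𝕂 × Matrix (Fin n) (Fin n) 𝕂))
    (hAd : ∀ g a, Ad g a =
      (g.2.val * a.1 - g.2.val * a.2 * (g.2⁻¹).val * g.1, g.2.val * a.2 * (g.2⁻¹).val))
    (α : (Matrix (Fin p) (Fin n) 𝕂 × Matrix (Fin n) (Fin n) 𝕂) →
      (Matrix (Fin n) (Fin p) 𝕂 × Matrix (Fin n) (Fin n) 𝕂) → 𝕂)
    (hα : ∀ f a, α f a = trace (a.1 * f.1) + trace (f.2 * a.2)) :
    α (H * (U⁻¹).val, U.val * N * (U⁻¹).val + X * H * (U⁻¹).val) (y, v)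
      = α (H, N) (Ad (-((U⁻¹).val * X), U⁻¹) (y, v)) := by
  rw [hAd, hα, hα]
  have hU : U.val * (U⁻¹).val = 1 := by simp
  have e1 : trace (y * (H * (U⁻¹).val)) = trace ((U⁻¹).val * y * H) := by
    rw [← Matrix.mul_assoc, Matrix.trace_mul_comm, Matrix.mul_assoc]
  have e2 : trace (U.val * N * (U⁻¹).val * v) = trace (N * ((U⁻¹).val * v * U.val)) := by
    rw [Matrix.mul_assoc, Matrix.mul_assoc, Matrix.trace_mul_comm, Matrix.mul_assoc]
  have e3 : trace (X * H * (U⁻¹).val * v) = trace ((U⁻¹).val * v * X * H) := by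
    rw [Matrix.mul_assoc, Matrix.trace_mul_comm, Matrix.mul_assoc _ X H]
  have e4 : (U⁻¹).val * v * U.val * -((U⁻¹).val * X) = -((U⁻¹).val * v * X) := by
    rw [Matrix.mul_neg, ← Matrix.mul_assoc, Matrix.mul_assoc _ U.val, hU, Matrix.mul_one]
  simp only [inv_inv]
  rw [e4, sub_neg_eq_add, Matrix.add_mul, Matrix.add_mul, Matrix.trace_add, Matrix.trace_add,
    e1, e2, e3]
  ring
end

section
/- The isotropy subalgebra of (H₀,N₀) under the coadjoint representation is trivial, and the coadjoint orbit of (H₀,N₀) is open: if (x,u) ∈ M_{n,p}(𝕂) × gl(n,𝕂) satisfies H₀·u = 0 and u·N₀ − N₀·u + x·H₀ = 0, then x = 0 and u = 0; consequently the orbit {(X,U)·(H₀,N₀) : (X,U) ∈ G_{n,p}(𝕂)} is an open subset of M_{p,n}(𝕂) × gl(n,𝕂). -/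
open Matrix

section aux

theorem aux_inj (𝕂 : Type) [RCLike 𝕂] (p k n : ℕ) (hp : 1 ≤ p) (hk : 1 ≤ k)
    (hn : n = k * p) (H₀ : Matrix (Fin p) (Fin n) 𝕂) (N₀ : Matrix (Fin n) (Fin n) 𝕂)
    (hH : H₀ = Matrix.of fun (i : Fin p) (j : Fin n) => if (j : ℕ) = n - p + (i : ℕ) then 1 else 0)
    (hN : N₀ = Matrix.of fun (i j : Fin n) => if (i : ℕ) = (j : ℕ) + p then 1 else 0)
    (x : Matrix (Fin n) (Fin p) 𝕂) (u : Matrix (Fin n) (Fin n) 𝕂)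
    (h1 : H₀ * u = 0) (h2 : u * N₀ - N₀ * u + x * H₀ = 0) : x = 0 ∧ u = 0 := by
  have hpn : p ≤ n := by rw [hn]; exact Nat.le_mul_of_pos_left p hk
  have A : ∀ a b : Fin n, n - p ≤ (a : ℕ) → u a b = 0 := by
    intro a b h
    have := congrFun (congrFun h1 ⟨a - (n - p), by omega⟩) b
    rw [Matrix.mul_apply, Finset.sum_eq_single a] at this
    · have e : (a : ℕ) = n - p + (a - (n - p)) := by omega
      simpa [hH, ← e] using this
    · intro c _ hc
      have : (c : ℕ) ≠ n - p + (a - (n - p)) := fun e => hc (Fin.ext (by omega))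
      simp [hH, this]
    · simp
  have B1 : ∀ (a b c : Fin n), (c : ℕ) = b + p → (u * N₀) a b = u a c := by
    intro a b c h
    rw [Matrix.mul_apply, Finset.sum_eq_single c]
    · simp [hN, h]
    · intro d _ hd
      have : (d : ℕ) ≠ b + p := fun e => hd (Fin.ext (by omega))
      simp [hN, this]
    · simp
  have B2 : ∀ (a b c : Fin n), (a : ℕ) = c + p → (N₀ * u) a b = u c b := by
    intro a b c h
    rw [Matrix.mul_apply, Finset.sum_eq_single c]
    · simp [hN, h]
    · intro d _ hd
      have : (a : ℕ) ≠ d + p := fun e => hd (Fin.ext (by omega))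
      simp [hN, this]
    · simp
  have B3 : ∀ (a b : Fin n), (a : ℕ) < p → (N₀ * u) a b = 0 := by
    intro a b h
    rw [Matrix.mul_apply]
    apply Finset.sum_eq_zero
    intro d _
    have : (a : ℕ) ≠ d + p := by omega
    simp [hN, this]
  have B4 : ∀ (a b : Fin n), (b : ℕ) < n - p → (x * H₀) a b = 0 := by
    intro a b h
    rw [Matrix.mul_apply]
    apply Finset.sum_eq_zero
    intro d _
    have : (b : ℕ) ≠ n - p + d := by omega
    simp [hH, this]
  have C : ∀ a b, (u * N₀) a b - (N₀ * u) a b + (x * H₀) a b = 0 := fun a b =>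
    congrFun (congrFun h2 a) b
  have D : ∀ a b c d : Fin n, (c : ℕ) = a + p → (d : ℕ) = b + p → u a b = u c d := by
    intro a b c d hc hd
    have := C c b
    rw [B1 c b d hd, B2 c b a hc, B4 c b (by omega)] at this
    simpa [sub_eq_zero, eq_comm] using this
  have E : ∀ a b d : Fin n, (a : ℕ) < p → (d : ℕ) = b + p → u a d = 0 := by
    intro a b d ha hd
    have := C a b
    rw [B1 a b d hd, B3 a b ha, B4 a b (by omega)] at this
    simpa using this
  have F : ∀ (m : ℕ) (a b c d : Fin n), (c : ℕ) = a + m * p → (d : ℕ) = b + m * p →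
      u a b = u c d := by
    intro m
    induction m with
    | zero =>
      intro a b c d hc hd
      rw [Fin.ext (show (c : ℕ) = a by omega), Fin.ext (show (d : ℕ) = b by omega)]
    | succ m ih =>
      intro a b c d hc hd
      rw [Nat.succ_mul] at hc hd
      rw [ih a b ⟨a + m * p, by omega⟩ ⟨b + m * p, by omega⟩ rfl rfl]
      exact D _ _ _ _ (by simp; omega) (by simp; omega)
  have G : ∀ (b : ℕ) (hb : b < n) (a : Fin n), u a ⟨b, hb⟩ = 0 := by
    intro b
    induction b using Nat.strong_induction_on with
    | _ b ih =>
      intro hb a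
      by_cases hbp : b < p
      · have hq : (a : ℕ) / p < k := by
          rw [Nat.div_lt_iff_lt_mul hp, ← hn]; exact a.2
        obtain ⟨m, hm⟩ : ∃ m, k = a / p + m + 1 := ⟨k - 1 - a / p, by omega⟩
        have hn' : n = p * (a / p) + m * p + p := by
          have e := congrArg (fun t => t * p) hm
          rw [← hn] at e
          refine e.trans ?_
          ring
        have := Nat.div_add_mod (a : ℕ) p
        have := Nat.mod_lt (a : ℕ) hp
        have hc : (a : ℕ) + m * p < n := by omega
        have hd : b + m * p < n := by omega
        rw [F m a ⟨b, hb⟩ ⟨_, hc⟩ ⟨_, hd⟩ rfl rfl]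
        exact A _ _ (by simp; omega)
      · by_cases ha : (a : ℕ) < p
        · exact E a ⟨b - p, by omega⟩ _ ha (by simp; omega)
        · rw [← D ⟨a - p, by omega⟩ ⟨b - p, by omega⟩ a ⟨b, hb⟩ (by simp; omega) (by simp; omega)]
          exact ih (b - p) (by omega) _ _
  have hu : u = 0 := by ext a b; exact G b b.2 a
  refine ⟨?_, hu⟩
  ext a i
  have := C a ⟨n - p + i, by omega⟩
  simp only [hu, Matrix.zero_mul, Matrix.mul_zero] at this
  rw [Matrix.mul_apply, Finset.sum_eq_single i] at this
  · simpa [hH] using this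
  · intro d _ hd
    have : (i : ℕ) ≠ d := fun e => hd (Fin.ext e.symm)
    simp [hH, this]
  · simp

theorem aux_inv {𝕂 E F Q : Type*} [RCLike 𝕂] [NormedAddCommGroup E] [NormedSpace 𝕂 E]
    [FiniteDimensional 𝕂 E] [NormedAddCommGroup F] [NormedSpace 𝕂 F] [FiniteDimensional 𝕂 F]
    [TopologicalSpace Q] (hd : Module.finrank 𝕂 E = Module.finrank 𝕂 F)
    (T : Q → E →ₗ[𝕂] F) (hT : ∀ e, Continuous fun q => T q e) (q₀ : Q)
    (hi : Function.Injective (T q₀)) (e : E) (S : Set E) (hS : S ∈ nhds e) :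
    ∀ᶠ q in nhds q₀, ∃ e' ∈ S, T q e' = T q₀ e := by
  have := FiniteDimensional.complete 𝕂 E
  let T' : Q → E →L[𝕂] F := fun q => LinearMap.toContinuousLinearMap (T q)
  have hT' : Continuous T' := continuous_clm_apply.2 hT
  let g : E ≃L[𝕂] F := (LinearEquiv.ofInjectiveOfFinrankEq (T q₀) hi hd).toContinuousLinearEquiv
  have hg : T' q₀ = g := by ext y; rfl
  have h1 : ∀ᶠ q in nhds q₀, T' q ∈ Set.range ((↑) : (E ≃L[𝕂] F) → E →L[𝕂] F) := by
    apply hT'.continuousAt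
    rw [hg]
    exact ContinuousLinearEquiv.nhds g
  have h2 : ContinuousAt (fun q => (T' q).inverse (T q₀ e)) q₀ := by
    have : ContinuousAt ContinuousLinearMap.inverse (T' q₀) := by
      rw [hg]
      exact (contDiffAt_map_inverse (n := 0) g).continuousAt
    exact (ContinuousAt.comp (f := T') this hT'.continuousAt).clm_apply continuousAt_const
  have h3 : (T' q₀).inverse (T q₀ e) = e := by
    rw [hg, ContinuousLinearMap.inverse_equiv]
    exact g.symm_apply_apply e
  have h4 := h2.eventually_mem (by rw [h3]; exact hS)
  filter_upwards [h1, h4] with q ⟨g', hg'⟩ hq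
  refine ⟨_, hq, ?_⟩
  rw [← hg', ContinuousLinearMap.inverse_equiv]
  have : T q = g'.toLinearMap := by
    ext y
    have := congrArg (fun l : E →L[𝕂] F => l y) hg'
    exact this.symm
  rw [this]
  exact g'.apply_symm_apply _

attribute [local instance] Matrix.normedAddCommGroup Matrix.normedSpace

theorem aux_open (𝕂 : Type) [RCLike 𝕂] (p n : ℕ)
    (H₀ : Matrix (Fin p) (Fin n) 𝕂) (N₀ : Matrix (Fin n) (Fin n) 𝕂)
    (hinj : ∀ (x : Matrix (Fin n) (Fin p) 𝕂) (u : Matrix (Fin n) (Fin n) 𝕂),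
       H₀ * u = 0 → u * N₀ - N₀ * u + x * H₀ = 0 → x = 0 ∧ u = 0) :
    IsOpen {q : Matrix (Fin p) (Fin n) 𝕂 × Matrix (Fin n) (Fin n) 𝕂 |
      ∃ (X : Matrix (Fin n) (Fin p) 𝕂) (U : GL (Fin n) 𝕂),
        q = (H₀ * (U⁻¹).val, U.val * N₀ * (U⁻¹).val + X * H₀ * (U⁻¹).val)} := by
  rw [isOpen_iff_mem_nhds]
  rintro q₀ ⟨X, U, hq⟩
  let T : (Matrix (Fin p) (Fin n) 𝕂 × Matrix (Fin n) (Fin n) 𝕂) →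
      (Matrix (Fin n) (Fin p) 𝕂 × Matrix (Fin n) (Fin n) 𝕂) →ₗ[𝕂]
      (Matrix (Fin p) (Fin n) 𝕂 × Matrix (Fin n) (Fin n) 𝕂) := fun q =>
    { toFun := fun e => (q.1 * e.2, q.2 * e.2 - e.2 * N₀ - e.1 * H₀)
      map_add' := by
        intro a b
        ext1
        · simp [Matrix.mul_add]
        · simp [Matrix.mul_add, Matrix.add_mul]; abel
      map_smul' := by
        intro c a
        ext1 <;> simp [smul_sub] }
  have hTa : ∀ q e, T q e = (q.1 * e.2, q.2 * e.2 - e.2 * N₀ - e.1 * H₀) := fun _ _ => rfl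
  have hUU : (U⁻¹).val * U.val = 1 := U.inv_mul
  have hUU' : U.val * (U⁻¹).val = 1 := U.mul_inv
  have hTq : T q₀ (X, U.val) = (H₀, 0) := by
    rw [hTa, hq]
    ext1
    · simp only [Matrix.mul_assoc, hUU, Matrix.mul_one]
    · simp only [Matrix.add_mul, Matrix.mul_assoc, hUU, Matrix.mul_one]
      abel
  have hi : Function.Injective (T q₀) := by
    rw [← LinearMap.ker_eq_bot, LinearMap.ker_eq_bot']
    rintro ⟨x, u⟩ h
    rw [hTa, hq] at h
    obtain ⟨ha, hb⟩ := Prod.mk.inj h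
    simp only [Prod.fst_zero, Prod.snd_zero] at ha hb
    rw [Matrix.mul_assoc] at ha
    have hb' := congrArg (fun M => -((U⁻¹).val * M)) hb
    simp only [Matrix.add_mul, Matrix.mul_assoc, ha, Matrix.mul_zero, add_zero, neg_zero,
      Matrix.mul_sub] at hb'
    rw [← Matrix.mul_assoc (U⁻¹).val U.val, hUU, Matrix.one_mul] at hb'
    obtain ⟨hx, hu⟩ := hinj ((U⁻¹).val * x) ((U⁻¹).val * u) ha (by
      rw [← hb']; simp only [Matrix.mul_assoc]; abel)
    have hx' : x = U.val * ((U⁻¹).val * x) := by rw [← Matrix.mul_assoc, hUU', Matrix.one_mul]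
    have hu' : u = U.val * ((U⁻¹).val * u) := by rw [← Matrix.mul_assoc, hUU', Matrix.one_mul]
    rw [hx', hu', hx, hu]
    simp
  have key := aux_inv (𝕂 := 𝕂) (by
    rw [Module.finrank_prod, Module.finrank_prod,
      (Matrix.transposeLinearEquiv (Fin n) (Fin p) 𝕂 𝕂).finrank_eq]) T
    (by
      intro e
      simp only [hTa]
      fun_prop) q₀ hi (X, U.val) {e | e.2.det ≠ 0} (by
      refine IsOpen.mem_nhds ?_ ?_
      · exact isOpen_ne_fun (by fun_prop) continuous_const
      · exact ((Matrix.isUnit_iff_isUnit_det _).1 U.isUnit).ne_zero)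
  refine Filter.mem_of_superset key ?_
  rintro ⟨H, N⟩ ⟨⟨x, u⟩, hu, he⟩
  rw [hTq, hTa] at he
  obtain ⟨ha, hb⟩ := Prod.mk.inj he
  simp only at ha hb
  let V : GL (Fin n) 𝕂 := Matrix.GeneralLinearGroup.mkOfDetNeZero u hu
  have hV : V.val = u := rfl
  have hVV : V.val * (V⁻¹).val = 1 := V.mul_inv
  refine ⟨x, V, ?_⟩
  have hN : N * V.val = V.val * N₀ + x * H₀ := by
    rw [hV, ← sub_eq_zero, ← hb]; abel
  ext1
  · simp only
    rw [← ha, ← hV, Matrix.mul_assoc, hVV, Matrix.mul_one]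
  · simp only
    rw [← Matrix.add_mul, ← hN, Matrix.mul_assoc, hVV, Matrix.mul_one]

end aux

/-- The isotropy subalgebra of `(H₀,N₀)` under the coadjoint representation of
`𝒢_{n,p}(𝕂)` is trivial, and consequently the coadjoint orbit
`{(X,U)·(H₀,N₀) : (X,U) ∈ G_{n,p}(𝕂)}` is open in `M_{p,n}(𝕂) × gl(n,𝕂)`.
Here `H₀` is the block row `(0,…,0,I_p)` and `N₀` has `I_p` on the first block subdiagonal
(`p×p` blocks) and zeros elsewhere. -/
theorem stmt3 (𝕂 : Type) [RCLike 𝕂] (p k n : ℕ) (hp : 1 ≤ p) (hk : 1 ≤ k)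
    (hn : n = k * p) :
    let H₀ : Matrix (Fin p) (Fin n) 𝕂 :=
      Matrix.of fun i j => if (j : ℕ) = n - p + (i : ℕ) then 1 else 0
    let N₀ : Matrix (Fin n) (Fin n) 𝕂 :=
      Matrix.of fun i j => if (i : ℕ) = (j : ℕ) + p then 1 else 0
    (∀ (x : Matrix (Fin n) (Fin p) 𝕂) (u : Matrix (Fin n) (Fin n) 𝕂),
       H₀ * u = 0 → u * N₀ - N₀ * u + x * H₀ = 0 → x = 0 ∧ u = 0) ∧
    IsOpen {q : Matrix (Fin p) (Fin n) 𝕂 × Matrix (Fin n) (Fin n) 𝕂 |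
      ∃ (X : Matrix (Fin n) (Fin p) 𝕂) (U : GL (Fin n) 𝕂),
        q = (H₀ * (U⁻¹).val, U.val * N₀ * (U⁻¹).val + X * H₀ * (U⁻¹).val)} := by
  intro H₀ N₀
  have h := aux_inj 𝕂 p k n hp hk hn H₀ N₀ rfl rfl
  exact ⟨h, aux_open 𝕂 p n H₀ N₀ h⟩
end

section
/- Let α₁ and α₂ be the linear forms on 𝒢_{n,p}(𝕂) defined by α₁(x,u) = tr(x·H₀) and α₂(x,u) = tr(N₀·u), and let α = α₁ + α₂ (so α = α_{(H₀,N₀)}). Let R_i = {a ∈ 𝒢_{n,p}(𝕂) : α_i([a,b]) = 0 for all b} be the radical of δα_i (i = 1,2). Then R₁ and R₂ are Lie subalgebras of 𝒢_{n,p}(𝕂), with dim R₁ = p²k(k−1) and dim R₂ = 2p²k; 𝒢_{n,p}(𝕂) = R₁ ⊕ R₂ as vector spaces; and the restriction of δα to each R_i is nondegenerate (R₁ and R₂ are supplementary symplectic Lie subalgebras of (𝒢_{n,p}(𝕂), δα)). -/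
open Matrix

/-- The underlying space of the Lie algebra `𝒢_{n,p}(𝕂) = M_{n,p}(𝕂) × gl(n,𝕂)`. -/
abbrev GA (𝕂 : Type) [RCLike 𝕂] (n p : ℕ) : Type :=
  Matrix (Fin n) (Fin p) 𝕂 × Matrix (Fin n) (Fin n) 𝕂

/-- The Lie bracket `[(x,u),(y,v)] = (u·y − v·x, u·v − v·u)` of `𝒢_{n,p}(𝕂)`. -/
def bkt {𝕂 : Type} [RCLike 𝕂] {n p : ℕ} (a b : GA 𝕂 n p) : GA 𝕂 n p :=
  (a.2 * b.1 - b.2 * a.1, a.2 * b.2 - b.2 * a.2)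

section lemmas

variable {𝕂 : Type} [RCLike 𝕂] {n p : ℕ}

theorem bkt_add_left (a a' b : GA 𝕂 n p) : bkt (a + a') b = bkt a b + bkt a' b := by
  refine Prod.ext ?_ ?_ <;>
    simp [bkt, Matrix.add_mul, Matrix.mul_add] <;> abel

theorem bkt_zero_left (b : GA 𝕂 n p) : bkt 0 b = 0 := by
  refine Prod.ext ?_ ?_ <;> simp [bkt]

theorem bkt_smul_left (c : 𝕂) (a b : GA 𝕂 n p) : bkt (c • a) b = c • bkt a b := by
  refine Prod.ext ?_ ?_ <;>
    simp [bkt, Matrix.smul_mul, Matrix.mul_smul, smul_sub]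

end lemmas

/-- The radical `{a : ∀ b, α([a,b]) = 0}` of the 2-coboundary `δα`. -/
def rad {𝕂 : Type} [RCLike 𝕂] {n p : ℕ} (α : GA 𝕂 n p →ₗ[𝕂] 𝕂) :
    Submodule 𝕂 (GA 𝕂 n p) where
  carrier := {a | ∀ b, α (bkt a b) = 0}
  add_mem' := fun {a a'} ha ha' b => by
    rw [bkt_add_left, map_add, ha b, ha' b, add_zero]
  zero_mem' := fun b => by rw [bkt_zero_left, map_zero]
  smul_mem' := fun c a ha b => by
    rw [bkt_smul_left, _root_.map_smul, ha b, smul_zero]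

/-- The block row `H₀ = (0,…,0,I_p) ∈ M_{p,n}(𝕂)`. -/
def H0 (𝕂 : Type) [RCLike 𝕂] (n p : ℕ) : Matrix (Fin p) (Fin n) 𝕂 :=
  Matrix.of fun i j => if (j : ℕ) = n - p + (i : ℕ) then 1 else 0

/-- The block subdiagonal matrix `N₀ ∈ gl(n,𝕂)`. -/
def N0 (𝕂 : Type) [RCLike 𝕂] (n p : ℕ) : Matrix (Fin n) (Fin n) 𝕂 :=
  Matrix.of fun i j => if (i : ℕ) = (j : ℕ) + p then 1 else 0

/-- The linear form `α₁(x,u) = tr(x·H₀)` on `𝒢_{n,p}(𝕂)`. -/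
def alpha1 (𝕂 : Type) [RCLike 𝕂] (n p : ℕ) : GA 𝕂 n p →ₗ[𝕂] 𝕂 where
  toFun a := trace (a.1 * H0 𝕂 n p)
  map_add' a b := by simp [Matrix.add_mul]
  map_smul' c a := by simp [Matrix.smul_mul]

/-- The linear form `α₂(x,u) = tr(N₀·u)` on `𝒢_{n,p}(𝕂)`. -/
def alpha2 (𝕂 : Type) [RCLike 𝕂] (n p : ℕ) : GA 𝕂 n p →ₗ[𝕂] 𝕂 where
  toFun a := trace (N0 𝕂 n p * a.2)
  map_add' a b := by simp [Matrix.mul_add]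
  map_smul' c a := by simp [Matrix.mul_smul]

theorem aux_H_mul {𝕂 : Type} [RCLike 𝕂] {n p : ℕ} (hpn : p ≤ n) {q : Type}
    (u : Matrix (Fin n) q 𝕂) (i : Fin p) (j : q) :
    (H0 𝕂 n p * u) i j = u ⟨n - p + i, by omega⟩ j := by
  rw [Matrix.mul_apply, Finset.sum_eq_single (⟨n - p + i, by omega⟩ : Fin n)]
  · simp [H0]
  · intro b _ hb
    have : (b : ℕ) ≠ n - p + i := fun h => hb (Fin.ext h)
    simp [H0, this]
  · simp

theorem aux_N_mul {𝕂 : Type} [RCLike 𝕂] {n p : ℕ}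
    (u : Matrix (Fin n) (Fin n) 𝕂) (i : Fin n) (j : Fin n) :
    (N0 𝕂 n p * u) i j = if p ≤ (i : ℕ) then u ⟨i - p, by omega⟩ j else 0 := by
  rw [Matrix.mul_apply]
  split_ifs with h
  · rw [Finset.sum_eq_single (⟨i - p, by omega⟩ : Fin n)]
    · simp [N0, h]
    · intro b _ hb
      have : ¬ (i : ℕ) = b + p := fun h => hb (Fin.ext (by simp; omega))
      simp [N0, this]
    · simp
  · apply Finset.sum_eq_zero
    intro b _
    have : ¬ (i : ℕ) = b + p := by omega
    simp [N0, this]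

theorem aux_mul_N {𝕂 : Type} [RCLike 𝕂] {n p : ℕ}
    (u : Matrix (Fin n) (Fin n) 𝕂) (i : Fin n) (j : Fin n) :
    (u * N0 𝕂 n p) i j = if h : (j : ℕ) + p < n then u i ⟨j + p, h⟩ else 0 := by
  rw [Matrix.mul_apply]
  split_ifs with h
  · rw [Finset.sum_eq_single (⟨j + p, h⟩ : Fin n)]
    · simp [N0]
    · intro b _ hb
      have : ¬ (b : ℕ) = j + p := fun h => hb (Fin.ext (by simp; omega))
      simp [N0, this]
    · simp
  · apply Finset.sum_eq_zero
    intro b _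
    have : ¬ (b : ℕ) = j + p := by omega
    simp [N0, this]

theorem aux_mul_H {𝕂 : Type} [RCLike 𝕂] {n p : ℕ} (hpn : p ≤ n)
    (x : Matrix (Fin n) (Fin p) 𝕂) (h : x * H0 𝕂 n p = 0) : x = 0 := by
  have hh : H0 𝕂 n p * (H0 𝕂 n p)ᵀ = 1 := by
    ext i j
    rw [aux_H_mul hpn]
    simp only [transpose_apply, H0, of_apply, Matrix.one_apply, Fin.ext_iff]
    congr 1
    simp
  calc x = x * (H0 𝕂 n p * (H0 𝕂 n p)ᵀ) := by rw [hh, Matrix.mul_one]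
    _ = 0 := by rw [← Matrix.mul_assoc, h, Matrix.zero_mul]

theorem aux_trace {𝕂 : Type} [RCLike 𝕂] {m q : ℕ} (A : Matrix (Fin m) (Fin q) 𝕂)
    (h : ∀ B : Matrix (Fin q) (Fin m) 𝕂, trace (A * B) = 0) : A = 0 := by
  ext i j
  have := h (Matrix.single j i 1)
  simpa [Matrix.trace_mul_single] using this

theorem aux_rad1 {𝕂 : Type} [RCLike 𝕂] {n p : ℕ} (hpn : p ≤ n) (a : GA 𝕂 n p) :
    a ∈ rad (alpha1 𝕂 n p) ↔ a.1 = 0 ∧ H0 𝕂 n p * a.2 = 0 := by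
  have key : ∀ b : GA 𝕂 n p, alpha1 𝕂 n p (bkt a b) =
      trace (H0 𝕂 n p * a.2 * b.1) - trace (a.1 * H0 𝕂 n p * b.2) := by
    intro b
    change trace ((a.2 * b.1 - b.2 * a.1) * H0 𝕂 n p) = _
    rw [Matrix.sub_mul, trace_sub, Matrix.trace_mul_comm, ← Matrix.mul_assoc,
      Matrix.mul_assoc b.2, Matrix.trace_mul_comm b.2]
  constructor
  · intro ha
    constructor
    · apply aux_mul_H hpn
      apply aux_trace
      intro B
      have := ha (0, B)
      rw [key] at this
      simpa using this
    · apply aux_trace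
      intro B
      have := ha (B, 0)
      rw [key] at this
      simpa using this
  · rintro ⟨h1, h2⟩ b
    rw [key, h1, h2]
    simp

theorem aux_rad2 {𝕂 : Type} [RCLike 𝕂] {n p : ℕ} (a : GA 𝕂 n p) :
    a ∈ rad (alpha2 𝕂 n p) ↔ N0 𝕂 n p * a.2 = a.2 * N0 𝕂 n p := by
  have key : ∀ b : GA 𝕂 n p, alpha2 𝕂 n p (bkt a b) =
      trace ((N0 𝕂 n p * a.2 - a.2 * N0 𝕂 n p) * b.2) := by
    intro b
    change trace (N0 𝕂 n p * (a.2 * b.2 - b.2 * a.2)) = _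
    rw [Matrix.sub_mul, trace_sub, Matrix.mul_sub, trace_sub, ← Matrix.mul_assoc,
      ← Matrix.mul_assoc, Matrix.trace_mul_comm _ a.2, Matrix.mul_assoc a.2]
  constructor
  · intro ha
    rw [← sub_eq_zero]
    apply aux_trace
    intro B
    have := ha (0, B)
    rwa [key] at this
  · intro h b
    rw [key, h]
    simp

theorem aux_inj_s7 {𝕂 : Type} [RCLike 𝕂] {n p : ℕ} (hp : 1 ≤ p) (hpn : p ≤ n)
    (u : Matrix (Fin n) (Fin n) 𝕂)
    (h1 : H0 𝕂 n p * u = 0) (h2 : N0 𝕂 n p * u = u * N0 𝕂 n p) : u = 0 := by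
  have key : ∀ m : ℕ, ∀ i : Fin n, n ≤ (i : ℕ) + m → ∀ j, u i j = 0 := by
    intro m
    induction m with
    | zero => intro i hi; omega
    | succ m ih =>
      intro i hi j
      by_cases hc : n - p ≤ (i : ℕ)
      · have := congrFun (congrFun h1 ⟨i - (n - p), by omega⟩) j
        rw [aux_H_mul hpn] at this
        rw [← show (⟨n - p + (i - (n - p)), by omega⟩ : Fin n) = i from Fin.ext (by simp; omega)]
        exact this
      · have := congrFun (congrFun h2 ⟨i + p, by omega⟩) j
        rw [aux_N_mul, aux_mul_N] at this
        simp only [Nat.le_add_left, if_true, Nat.add_sub_cancel] at this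
        rw [this]
        split_ifs with h
        · exact ih _ (by simp; omega) _
        · rfl
  ext i j
  exact key n i (by omega) j

theorem aux_surj {𝕂 : Type} [RCLike 𝕂] {n p k : ℕ} (hp : 1 ≤ p) (hk : 1 ≤ k) (hn : n = k * p)
    (hpn : p ≤ n) (w : Matrix (Fin p) (Fin n) 𝕂) :
    ∃ c : Matrix (Fin n) (Fin n) 𝕂, H0 𝕂 n p * c = w ∧ N0 𝕂 n p * c = c * N0 𝕂 n p := by
  obtain ⟨l, rfl⟩ : ∃ l, k = l + 1 := ⟨k - 1, by omega⟩
  have hn' : n = l * p + p := by rw [hn]; ring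
  refine ⟨Matrix.of fun i j => if h : (j : ℕ) + p * (l - i / p) < n then
    w ⟨i % p, Nat.mod_lt _ hp⟩ ⟨j + p * (l - i / p), h⟩ else 0, ?_, ?_⟩
  · ext i j
    rw [aux_H_mul hpn]
    have e : n - p + (i : ℕ) = i + l * p := by omega
    have e1 : (n - p + (i : ℕ)) / p = l := by
      rw [e, Nat.add_mul_div_right _ _ hp, Nat.div_eq_of_lt i.2]; simp
    have e2 : (n - p + (i : ℕ)) % p = i := by
      rw [e, Nat.add_mul_mod_self_right, Nat.mod_eq_of_lt i.2]
    simp [e1, e2]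
  · ext i j
    rw [aux_N_mul, aux_mul_N]
    simp only [of_apply]
    by_cases hi : p ≤ (i : ℕ)
    · have hdl : (i : ℕ) / p < l + 1 := by
        rw [Nat.div_lt_iff_lt_mul hp]; rw [← hn]; exact i.2
      have hd : ((i : ℕ) - p) / p = i / p - 1 := by
        simpa using Nat.sub_mul_div (i : ℕ) p 1
      have hd1 : 1 ≤ (i : ℕ) / p := (Nat.one_le_div_iff hp).2 hi
      have hm : ((i : ℕ) - p) % p = i % p := (Nat.mod_eq_sub_mod hi).symm
      have ht : (j : ℕ) + p * (l - ((i : ℕ) - p) / p) = j + p + p * (l - i / p) := by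
        rw [hd, show l - ((i : ℕ) / p - 1) = (l - i / p) + 1 by omega]; ring
      simp only [hi, if_true, ht, hm]
      split_ifs with h1 h2
      · rfl
      · omega
      · rfl
      · rfl
    · have h0 : (i : ℕ) / p = 0 := Nat.div_eq_of_lt (by omega)
      have : p * l = l * p := Nat.mul_comm _ _
      simp only [hi, if_false, h0, Nat.sub_zero]
      split_ifs with h1 h2
      · omega
      · rfl
      · rfl

theorem aux_dim1 {𝕂 : Type} [RCLike 𝕂] {n p k : ℕ} (hp : 1 ≤ p) (hk : 1 ≤ k) (hn : n = k * p)
    (hpn : p ≤ n) : Module.finrank 𝕂 (rad (alpha1 𝕂 n p)) + 2 * (n * p) = n * p + n * n := by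
  let f : GA 𝕂 n p →ₗ[𝕂] (Matrix (Fin n) (Fin p) 𝕂 × Matrix (Fin p) (Fin n) 𝕂) :=
    { toFun := fun a => (a.1, H0 𝕂 n p * a.2)
      map_add' := fun a b => by simp [Matrix.mul_add]
      map_smul' := fun c a => by simp }
  have hker : LinearMap.ker f = rad (alpha1 𝕂 n p) := by
    ext a
    rw [aux_rad1 hpn, LinearMap.mem_ker]
    change (a.1, H0 𝕂 n p * a.2) = (0, 0) ↔ _
    rw [Prod.mk.injEq]
  have hr : LinearMap.range f = ⊤ := by
    rw [LinearMap.range_eq_top]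
    rintro ⟨x, w⟩
    obtain ⟨c, hc, -⟩ := aux_surj hp hk hn hpn w
    exact ⟨(x, c), by change (x, H0 𝕂 n p * c) = _; rw [hc]⟩
  have := LinearMap.finrank_range_add_finrank_ker f
  rw [hker, hr, finrank_top, Module.finrank_prod, Module.finrank_prod,
    Module.finrank_matrix, Module.finrank_matrix, Module.finrank_matrix] at this
  simp at this
  linarith [Nat.mul_comm n p]

theorem aux_skew {𝕂 : Type} [RCLike 𝕂] {n p : ℕ} (a b : GA 𝕂 n p) : bkt a b = - bkt b a := by
  refine Prod.ext ?_ ?_ <;> simp [bkt]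

theorem aux_nondeg {𝕂 : Type} [RCLike 𝕂] {n p : ℕ} (f g : GA 𝕂 n p →ₗ[𝕂] 𝕂)
    (hi : rad f ⊓ rad g = ⊥) (hs : rad f ⊔ rad g = ⊤) (a : GA 𝕂 n p) (ha : a ∈ rad f)
    (h : ∀ b ∈ rad f, -(f + g) (bkt a b) = 0) : a = 0 := by
  have : a ∈ rad f ⊓ rad g := by
    refine ⟨ha, fun b => ?_⟩
    obtain ⟨b1, h1, b2, h2, rfl⟩ := Submodule.mem_sup.1 (hs ▸ Submodule.mem_top : b ∈ rad f ⊔ rad g)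
    have e1 := h b1 h1
    rw [LinearMap.add_apply, ha b1, zero_add, neg_eq_zero] at e1
    have e2 := h2 a
    have e3 := h1
    rw [aux_skew, bkt_add_left, neg_add, map_add, ← aux_skew, e1, zero_add, map_neg, e2, neg_zero]
  rw [hi] at this
  simpa using this

/-- The radicals `R₁ = Rad(δα₁)` and `R₂ = Rad(δα₂)` are Lie subalgebras of
`𝒢_{n,p}(𝕂)` of dimensions `p²k(k−1)` and `2p²k`; `𝒢_{n,p}(𝕂) = R₁ ⊕ R₂` as vector spaces;
and the restriction of `δα` (with `α = α₁ + α₂ = α_{(H₀,N₀)}`) to each `R_i` is nondegenerate: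
they are supplementary symplectic Lie subalgebras of `(𝒢_{n,p}(𝕂), δα)`. -/
theorem stmt7 (𝕂 : Type) [RCLike 𝕂] (p k n : ℕ) (hp : 1 ≤ p) (hk : 1 ≤ k)
    (hn : n = k * p) :
    (∀ a ∈ rad (alpha1 𝕂 n p), ∀ b ∈ rad (alpha1 𝕂 n p), bkt a b ∈ rad (alpha1 𝕂 n p)) ∧
    (∀ a ∈ rad (alpha2 𝕂 n p), ∀ b ∈ rad (alpha2 𝕂 n p), bkt a b ∈ rad (alpha2 𝕂 n p)) ∧
    Module.finrank 𝕂 (rad (alpha1 𝕂 n p)) = p ^ 2 * k * (k - 1) ∧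
    Module.finrank 𝕂 (rad (alpha2 𝕂 n p)) = 2 * p ^ 2 * k ∧
    rad (alpha1 𝕂 n p) ⊓ rad (alpha2 𝕂 n p) = ⊥ ∧
    rad (alpha1 𝕂 n p) ⊔ rad (alpha2 𝕂 n p) = ⊤ ∧
    (∀ a ∈ rad (alpha1 𝕂 n p),
      (∀ b ∈ rad (alpha1 𝕂 n p), -(alpha1 𝕂 n p + alpha2 𝕂 n p) (bkt a b) = 0) → a = 0) ∧
    (∀ a ∈ rad (alpha2 𝕂 n p),
      (∀ b ∈ rad (alpha2 𝕂 n p), -(alpha1 𝕂 n p + alpha2 𝕂 n p) (bkt a b) = 0) → a = 0) := by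
  have hpn : p ≤ n := by rw [hn]; exact Nat.le_mul_of_pos_left p hk
  have hi : rad (alpha1 𝕂 n p) ⊓ rad (alpha2 𝕂 n p) = ⊥ := by
    rw [eq_bot_iff]
    rintro a ⟨h1, h2⟩
    have h1' := (aux_rad1 hpn a).1 h1
    have h2' := (aux_rad2 a).1 h2
    exact (Submodule.mem_bot 𝕂).2 (Prod.ext h1'.1 (aux_inj_s7 hp hpn _ h1'.2 h2'))
  have hs : rad (alpha1 𝕂 n p) ⊔ rad (alpha2 𝕂 n p) = ⊤ := by
    rw [eq_top_iff]
    rintro ⟨x, u⟩ -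
    obtain ⟨c, hc, hc2⟩ := aux_surj hp hk hn hpn (H0 𝕂 n p * u)
    refine Submodule.mem_sup.2 ⟨(0, u - c), ?_, (x, c), ?_, ?_⟩
    · rw [aux_rad1 hpn]
      exact ⟨rfl, by rw [Matrix.mul_sub, hc, sub_self]⟩
    · rw [aux_rad2]
      exact hc2
    · simp
  have hd := aux_dim1 (𝕂 := 𝕂) hp hk hn hpn
  have hd1 : Module.finrank 𝕂 (rad (alpha1 𝕂 n p)) = p ^ 2 * k * (k - 1) := by
    obtain ⟨l, rfl⟩ : ∃ l, k = l + 1 := ⟨k - 1, by omega⟩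
    subst hn
    simp only [Nat.add_sub_cancel]
    nlinarith
  refine ⟨?_, ?_, hd1, ?_, hi, hs, ?_, ?_⟩
  · intro a ha b hb
    rw [aux_rad1 hpn] at *
    constructor
    · simp [bkt, ha.1, hb.1]
    · simp only [bkt]
      rw [Matrix.mul_sub, ← Matrix.mul_assoc, ← Matrix.mul_assoc, ha.2, hb.2]
      simp
  · intro a ha b hb
    rw [aux_rad2] at *
    simp only [bkt]
    rw [Matrix.mul_sub, Matrix.sub_mul, ← Matrix.mul_assoc, ← Matrix.mul_assoc, ha, hb,
      Matrix.mul_assoc, Matrix.mul_assoc, ha, hb, Matrix.mul_assoc, Matrix.mul_assoc]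
  · have := Submodule.finrank_sup_add_finrank_inf_eq (rad (alpha1 𝕂 n p)) (rad (alpha2 𝕂 n p))
    rw [hi, hs, finrank_top, finrank_bot, Module.finrank_prod,
      Module.finrank_matrix, Module.finrank_matrix] at this
    simp at this
    have e : 2 * p ^ 2 * k = 2 * (n * p) := by rw [hn]; ring
    omega
  · exact fun a ha h => aux_nondeg _ _ hi hs a ha h
  · intro a ha h
    refine aux_nondeg _ _ (inf_comm (rad (alpha1 𝕂 n p)) _ ▸ hi)
      (sup_comm (rad (alpha1 𝕂 n p)) _ ▸ hs) a ha ?_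
    intro b hb
    rw [add_comm]
    exact h b hb
end

section
/- The radical R₂ = {a ∈ 𝒢_{n,p}(𝕂) : α₂([a,b]) = 0 for all b} of δα₂, where α₂(x,u) = tr(N₀·u), equals M_{n,p}(𝕂) × C(N₀), where C(N₀) = {u ∈ gl(n,𝕂) : u·N₀ = N₀·u} is the centralizer of N₀. Moreover u ∈ gl(n,𝕂) commutes with N₀ if and only if there exist matrices A₀, …, A_{k−1} ∈ M_p(𝕂) such that, in p×p block form, the (i,j) block of u equals A_{i−j} whenever i ≥ j and equals 0 whenever i < j (u is block lower-triangular and block-Toeplitz). -/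
open Matrix

lemma mulN0_apply {𝕂 : Type} [RCLike 𝕂] {n p : ℕ} (u : Matrix (Fin n) (Fin n) 𝕂) (i j : Fin n) :
    (u * N0 𝕂 n p) i j = if h : (j : ℕ) + p < n then u i ⟨j + p, h⟩ else 0 := by
  rw [Matrix.mul_apply]
  split_ifs with h
  · rw [Finset.sum_eq_single (⟨j + p, h⟩ : Fin n)]
    · simp [N0]
    · intro b _ hb
      have : (b : ℕ) ≠ j + p := fun e => hb (Fin.ext e)
      simp [N0, this]
    · simp
  · apply Finset.sum_eq_zero
    intro b _
    have : (b : ℕ) ≠ j + p := by have := b.2; omega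
    simp [N0, this]

lemma N0mul_apply {𝕂 : Type} [RCLike 𝕂] {n p : ℕ} (u : Matrix (Fin n) (Fin n) 𝕂) (i j : Fin n) :
    (N0 𝕂 n p * u) i j =
      if p ≤ (i : ℕ) then u ⟨i - p, lt_of_le_of_lt (Nat.sub_le _ _) i.2⟩ j else 0 := by
  rw [Matrix.mul_apply]
  split_ifs with h
  · rw [Finset.sum_eq_single (⟨i - p, lt_of_le_of_lt (Nat.sub_le _ _) i.2⟩ : Fin n)]
    · simp [N0, h]
    · intro b _ hb
      have : (i : ℕ) ≠ b + p := fun e => hb (Fin.ext (by simp; omega))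
      simp [N0, this]
    · simp
  · apply Finset.sum_eq_zero
    intro b _
    have : (i : ℕ) ≠ b + p := by omega
    simp [N0, this]

lemma toep_aux {𝕂 : Type} [RCLike 𝕂] {n p : ℕ} (hp : 0 < p) (u : Matrix (Fin n) (Fin n) 𝕂)
    (h : u * N0 𝕂 n p = N0 𝕂 n p * u) (q : ℕ) : ∀ (i s : ℕ) (hi : i < n) (hj : q * p + s < n),
      u ⟨i, hi⟩ ⟨q * p + s, hj⟩ = if q * p ≤ i then
        u ⟨i - q * p, lt_of_le_of_lt (Nat.sub_le _ _) hi⟩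
          ⟨s, lt_of_le_of_lt (Nat.le_add_left _ _) hj⟩ else 0 := by
  induction q with
  | zero => intro i s hi hj; simp
  | succ q ih =>
    intro i s hi hj
    have e : (q + 1) * p + s = (q * p + s) + p := by ring
    have e2 : (q + 1) * p = q * p + p := by ring
    have hj' : q * p + s < n := by omega
    have key := congrFun (congrFun h ⟨i, hi⟩) ⟨q * p + s, hj'⟩
    rw [mulN0_apply, N0mul_apply, dif_pos (by simp; omega)] at key
    simp only [e]
    rw [key]
    by_cases hpi : p ≤ i
    · rw [if_pos hpi, ih]
      by_cases hq : q * p ≤ i - p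
      · rw [if_pos hq, if_pos (by omega)]
        congr 2
        simp only
        omega
      · rw [if_neg hq, if_neg (by omega)]
    · rw [if_neg hpi, if_neg (by omega)]

/-- The radical `R₂ = Rad(δα₂)` of `δα₂`, where `α₂(x,u) = tr(N₀·u)`, equals
`M_{n,p}(𝕂) × C(N₀)` with `C(N₀)` the centralizer of `N₀`; and `u` commutes with `N₀` iff
`u` is block lower-triangular and block-Toeplitz: there are `A₀,…,A_{k−1} ∈ M_p(𝕂)` with
the `(i,j)` block of `u` equal to `A_{i−j}` for `i ≥ j` and to `0` for `i < j`. -/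
theorem stmt9 (𝕂 : Type) [RCLike 𝕂] (p k n : ℕ) (hp : 0 < p) (hk : 1 ≤ k)
    (hn : n = k * p) :
    -- R₂ = M_{n,p}(𝕂) × C(N₀)
    (∀ a : GA 𝕂 n p,
      (∀ b : GA 𝕂 n p, trace (N0 𝕂 n p * (bkt a b).2) = 0) ↔
        a.2 * N0 𝕂 n p = N0 𝕂 n p * a.2) ∧
    -- block description of the centralizer C(N₀)
    (∀ u : Matrix (Fin n) (Fin n) 𝕂,
      u * N0 𝕂 n p = N0 𝕂 n p * u ↔
        ∃ A : ℕ → Matrix (Fin p) (Fin p) 𝕂,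
          ∀ i j : Fin n, u i j =
            if (j : ℕ) / p ≤ (i : ℕ) / p
            then A ((i : ℕ) / p - (j : ℕ) / p)
                ⟨(i : ℕ) % p, Nat.mod_lt _ hp⟩ ⟨(j : ℕ) % p, Nat.mod_lt _ hp⟩
            else 0) := by
  constructor
  · intro a
    have key : ∀ b : GA 𝕂 n p, trace (N0 𝕂 n p * (bkt a b).2) =
        trace ((N0 𝕂 n p * a.2 - a.2 * N0 𝕂 n p) * b.2) := by
      intro b
      simp only [bkt, Matrix.mul_sub, Matrix.sub_mul, Matrix.trace_sub]
      rw [← Matrix.mul_assoc, ← Matrix.mul_assoc, Matrix.trace_mul_comm (N0 𝕂 n p * b.2) a.2,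
        ← Matrix.mul_assoc]
    constructor
    · intro h
      have h0 : N0 𝕂 n p * a.2 - a.2 * N0 𝕂 n p = 0 := by
        ext i j
        have := h (0, Matrix.single j i 1)
        rw [key] at this
        simpa [Matrix.trace_mul_single] using this
      exact (sub_eq_zero.mp h0).symm
    · intro h b
      rw [key, h]; simp
  · intro u
    constructor
    · intro h
      refine ⟨fun d => Matrix.of fun r s =>
        if hh : d * p + r < n ∧ (s : ℕ) < n then u ⟨d * p + r, hh.1⟩ ⟨s, hh.2⟩ else 0, ?_⟩
      rintro ⟨i, hi⟩ ⟨j, hj⟩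
      have ej : j / p * p + j % p = j := Nat.div_add_mod' j p
      have ei : i / p * p + i % p = i := Nat.div_add_mod' i p
      have ht := toep_aux hp u h (j / p) i (j % p) hi (by omega)
      simp only [ej] at ht
      rw [ht]
      have hiff : j / p * p ≤ i ↔ j / p ≤ i / p := (Nat.le_div_iff_mul_le hp).symm
      by_cases hle : j / p ≤ i / p
      · have em : (i / p - j / p) * p + i % p = i - j / p * p := by
          have := Nat.mul_le_mul_right p hle
          rw [Nat.sub_mul]; omega
        simp only [if_pos (hiff.2 hle), if_pos hle, Matrix.of_apply, em]
        rw [dif_pos ⟨by omega, by omega⟩]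
      · simp only [if_neg hle, if_neg (fun x => hle (hiff.1 x))]
    · rintro ⟨A, hA⟩
      ext ⟨i, hi⟩ ⟨j, hj⟩
      rw [mulN0_apply, N0mul_apply]
      by_cases hpi : p ≤ i
      · obtain ⟨i', rfl⟩ : ∃ i', i = i' + p := ⟨i - p, by omega⟩
        rw [if_pos hpi]
        by_cases hjn : j + p < n
        · rw [dif_pos hjn, hA, hA]
          simp [Nat.add_div_right _ hp]
        · rw [dif_neg hjn, hA, if_neg]
          simp only [Nat.add_sub_cancel, not_le]
          have h1 : (i' + p) / p < k := by rw [Nat.div_lt_iff_lt_mul hp]; omega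
          have h2 : k ≤ (j + p) / p := by rw [Nat.le_div_iff_mul_le hp]; omega
          rw [Nat.add_div_right _ hp] at h1 h2
          omega
      · rw [if_neg hpi]
        by_cases hjn : j + p < n
        · rw [dif_pos hjn, hA, if_neg]
          simp only [Nat.add_div_right _ hp, Nat.div_eq_of_lt (not_le.1 hpi)]
          exact Nat.not_succ_le_zero _
        · rw [dif_neg hjn]
end

section
/- Over ℝ, the coadjoint action of the identity component of G_{n,p}(ℝ) has exactly two open orbits: for the action (X,U)·(H,N) = (H·U⁻¹, U·N·U⁻¹ + X·H·U⁻¹) of the group G₀ = {(X,U) : X ∈ M_{n,p}(ℝ), U ∈ GL(n,ℝ), det U > 0} on M_{p,n}(ℝ) × gl(n,ℝ), there exist two points whose G₀-orbits are open and disjoint, and every point whose G₀-orbit is open lies in one of these two orbits. -/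
open Matrix

namespace CoadjAux

def obs {R : Type*} [CommRing R] {p k : ℕ} (H : Matrix (Fin p) (Fin (k*p)) R)
    (N : Matrix (Fin (k*p)) (Fin (k*p)) R) : Matrix (Fin (k*p)) (Fin (k*p)) R :=
  Matrix.of fun i l => (H * N ^ ((finProdFinEquiv.symm i).1 : ℕ)) (finProdFinEquiv.symm i).2 l

variable {p k : ℕ}

lemma obs_apply {R : Type*} [CommRing R] (H : Matrix (Fin p) (Fin (k*p)) R)
    (N : Matrix (Fin (k*p)) (Fin (k*p)) R) (j : Fin k) (a : Fin p) (l) :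
    obs H N (finProdFinEquiv (j,a)) l = (H * N ^ (j:ℕ)) a l := by
  simp only [obs, Matrix.of_apply, Equiv.symm_apply_apply]

lemma obs_mul_apply {R : Type*} [CommRing R] {m : Type*} (H : Matrix (Fin p) (Fin (k*p)) R)
    (N : Matrix (Fin (k*p)) (Fin (k*p)) R) (M : Matrix (Fin (k*p)) m R)
    (j : Fin k) (a : Fin p) (l) :
    (obs H N * M) (finProdFinEquiv (j,a)) l = (H * N ^ (j:ℕ) * M) a l := by
  rw [Matrix.mul_apply, Matrix.mul_apply]
  simp only [obs_apply]

lemma ext_row {R : Type*} {m : Type*} {A B : Matrix (Fin (k*p)) m R}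
    (h : ∀ (j : Fin k) (a : Fin p) l, A (finProdFinEquiv (j,a)) l = B (finProdFinEquiv (j,a)) l) :
    A = B := by
  ext i l
  obtain ⟨⟨j, a⟩, rfl⟩ := finProdFinEquiv.surjective i
  exact h j a l

lemma obs_map {R S : Type*} [CommRing R] [CommRing S] (f : R →+* S)
    (H : Matrix (Fin p) (Fin (k*p)) R)
    (N : Matrix (Fin (k*p)) (Fin (k*p)) R) :
    (obs H N).map f = obs (H.map f) (N.map f) := by
  apply ext_row
  intro j a l
  rw [obs_apply, Matrix.map_apply, obs_apply, ← Matrix.map_apply (f := f), Matrix.map_mul,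
    Matrix.map_pow]

lemma obs_conj (H : Matrix (Fin p) (Fin (k*p)) ℝ)
    (N U : Matrix (Fin (k*p)) (Fin (k*p)) ℝ) (hU : IsUnit U.det) :
    obs (H * U⁻¹) (U * N * U⁻¹) = obs H N * U⁻¹ := by
  apply ext_row
  intro j a l
  rw [obs_apply, obs_mul_apply]
  congr 2
  have : ∀ j : ℕ, H * U⁻¹ * (U * N * U⁻¹)^j = H * N^j * U⁻¹ := by
    intro j
    induction j with
    | zero => simp
    | succ j ih =>
      rw [pow_succ, ← Matrix.mul_assoc, ih, pow_succ]
      simp only [Matrix.mul_assoc]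
      rw [← Matrix.mul_assoc U⁻¹ U, Matrix.nonsing_inv_mul _ hU, Matrix.one_mul]
  exact congrFun (congrFun (this j) a) l

/-- output injection keeps observability -/
lemma obs_inj_ne (H : Matrix (Fin p) (Fin (k*p)) ℝ)
    (N : Matrix (Fin (k*p)) (Fin (k*p)) ℝ) (X : Matrix (Fin (k*p)) (Fin p) ℝ)
    (h : (obs H N).det ≠ 0) : (obs H (N + X * H)).det ≠ 0 := by
  intro h0
  obtain ⟨v, hv, hv0⟩ := Matrix.exists_mulVec_eq_zero_iff.mpr h0
  apply h
  apply Matrix.exists_mulVec_eq_zero_iff.mp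
  refine ⟨v, hv, ?_⟩
  have key : ∀ (M : Matrix (Fin (k*p)) (Fin (k*p)) ℝ) (j : Fin k) (a : Fin p),
      (obs H M *ᵥ v) (finProdFinEquiv (j,a)) = (H *ᵥ ((M ^ (j:ℕ)) *ᵥ v)) a := by
    intro M j a
    rw [Matrix.mulVec_mulVec]
    simp only [Matrix.mulVec, dotProduct, obs_apply]
  have h1 : ∀ j : ℕ, j < k → H *ᵥ (((N + X * H) ^ j) *ᵥ v) = 0 := by
    intro j hj
    ext a
    rw [← key _ ⟨j, hj⟩ a, hv0]; rfl
  have h2 : ∀ j : ℕ, j < k → ((N + X * H) ^ j) *ᵥ v = (N ^ j) *ᵥ v := by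
    intro j
    induction j with
    | zero => intro _; simp
    | succ j ih =>
      intro hj
      have e1 := h1 j (by omega)
      have e2 := ih (by omega)
      rw [pow_succ', ← Matrix.mulVec_mulVec, Matrix.add_mulVec, ← Matrix.mulVec_mulVec, e1, e2,
        pow_succ', ← Matrix.mulVec_mulVec]
      simp
  ext i
  obtain ⟨⟨j, a⟩, rfl⟩ := finProdFinEquiv.surjective i
  rw [key, ← h2 j j.2, h1 j j.2]; rfl

lemma obs_cont : Continuous fun q : Matrix (Fin p) (Fin (k*p)) ℝ ×
    Matrix (Fin (k*p)) (Fin (k*p)) ℝ => (obs q.1 q.2).det := by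
  apply Continuous.matrix_det
  apply continuous_matrix
  intro i l
  obtain ⟨⟨j, a⟩, rfl⟩ := finProdFinEquiv.surjective i
  simp only [obs_apply]
  exact (continuous_fst.matrix_mul (continuous_snd.pow _)).matrix_elem a l

/-- output injection keeps the sign -/
lemma obs_inj_sign (H : Matrix (Fin p) (Fin (k*p)) ℝ)
    (N : Matrix (Fin (k*p)) (Fin (k*p)) ℝ) (X : Matrix (Fin (k*p)) (Fin p) ℝ)
    (h : (obs H N).det ≠ 0) : 0 < (obs H N).det * (obs H (N + X * H)).det := by
  by_contra hc
  set f : ℝ → ℝ := fun t => (obs H N).det * (obs H (N + (t • X) * H)).det with hf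
  have hfc : Continuous f := by
    have : Continuous fun t : ℝ => (H, N + (t • X) * H) := by
      refine continuous_const.prodMk (continuous_const.add ?_)
      exact (continuous_id.smul continuous_const).matrix_mul continuous_const
    exact continuous_const.mul (obs_cont.comp this)
  have f0 : 0 ≤ f 0 := by simp [hf]; exact mul_self_nonneg _
  have f1 : f 1 ≤ 0 := by simpa [hf] using hc
  obtain ⟨t, -, ht⟩ := intermediate_value_Icc' (zero_le_one) hfc.continuousOn ⟨f1, f0⟩
  exact mul_ne_zero h (obs_inj_ne H N (t • X) h) ht

lemma nilp (hk : 1 ≤ k) (H : Matrix (Fin p) (Fin (k*p)) ℝ)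
    (N : Matrix (Fin (k*p)) (Fin (k*p)) ℝ) (V : Matrix (Fin (k*p)) (Fin p) ℝ)
    (h : (obs H N).det ≠ 0) (hV : ∀ j, j < k - 1 → H * N ^ j * V = 0)
    (hV1 : H * N ^ (k-1) * V = 1) (hV2 : N ^ k * V = 0) : N ^ k = 0 := by
  set A := N ^ k * (obs H N)⁻¹ with hA
  have hAO : A * obs H N = N ^ k := by
    rw [hA, Matrix.mul_assoc, Matrix.nonsing_inv_mul _ (isUnit_iff_ne_zero.mpr h), Matrix.mul_one]
  let B : Fin k → Matrix (Fin (k*p)) (Fin p) ℝ := fun j => Matrix.of fun i b =>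
    A i (finProdFinEquiv (j,b))
  have hB : N ^ k = ∑ j, B j * (H * N ^ (j:ℕ)) := by
    rw [← hAO]
    ext i l
    rw [Matrix.mul_apply, Matrix.sum_apply, ← finProdFinEquiv.sum_comp, Fintype.sum_prod_type]
    refine Finset.sum_congr rfl fun j _ => ?_
    rw [Matrix.mul_apply]
    simp only [obs_apply, B, Matrix.of_apply]
  have hB0 : ∀ m : ℕ, ∀ j : Fin k, (j:ℕ) + m = k - 1 → B j = 0 := by
    intro m
    induction m using Nat.strong_induction_on with
    | _ m ih =>
      intro j hj
      have e : N ^ k * (N ^ m * V) = 0 := by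
        rw [← Matrix.mul_assoc, ← pow_add, add_comm, pow_add, Matrix.mul_assoc, hV2,
          Matrix.mul_zero]
      rw [hB, Matrix.sum_mul, Finset.sum_eq_single j] at e
      · have : B j * (H * N ^ (j:ℕ)) * (N ^ m * V) = B j * (H * N ^ (k-1) * V) := by
          rw [← hj, pow_add]; simp only [Matrix.mul_assoc]
        rw [this, hV1, Matrix.mul_one] at e
        exact e
      · intro i _ hij
        rcases lt_or_gt_of_ne (fun hh => hij (Fin.ext hh) : (i:ℕ) ≠ j) with hlt | hgt
        · have : B i * (H * N ^ (i:ℕ)) * (N ^ m * V) = B i * (H * N ^ (i+m:ℕ) * V) := by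
            rw [pow_add]; simp only [Matrix.mul_assoc]
          rw [this, hV _ (by omega), Matrix.mul_zero]
        · rw [ih (k - 1 - i) (by omega) i (by omega), Matrix.zero_mul, Matrix.zero_mul]
      · intro hh; exact absurd (Finset.mem_univ _) hh
  rw [hB]
  refine Finset.sum_eq_zero fun j _ => ?_
  rw [hB0 (k-1-j) j (by omega), Matrix.zero_mul]

lemma exists_nilp (hk : 1 ≤ k) (H : Matrix (Fin p) (Fin (k*p)) ℝ)
    (N : Matrix (Fin (k*p)) (Fin (k*p)) ℝ)
    (h : (obs H N).det ≠ 0) : ∃ X : Matrix (Fin (k*p)) (Fin p) ℝ, (N + X * H) ^ k = 0 := by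
  let E : Matrix (Fin (k*p)) (Fin p) ℝ := Matrix.of fun i b =>
    if ((finProdFinEquiv.symm i).1 : ℕ) = k - 1 then
      (1 : Matrix (Fin p) (Fin p) ℝ) (finProdFinEquiv.symm i).2 b else 0
  set V := (obs H N)⁻¹ * E with hVdef
  have hOV : obs H N * V = E := by
    rw [hVdef, ← Matrix.mul_assoc, Matrix.mul_nonsing_inv _ (isUnit_iff_ne_zero.mpr h),
      Matrix.one_mul]
  have hE : ∀ j (hj : j < k) (a b : Fin p), (H * N ^ j * V) a b =
      if j = k - 1 then (1 : Matrix (Fin p) (Fin p) ℝ) a b else 0 := by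
    intro j hj a b
    rw [← obs_mul_apply H N V ⟨j, hj⟩ a b, hOV]
    simp only [E, Matrix.of_apply]
    rw [Equiv.symm_apply_apply]
  have hV : ∀ j, j < k - 1 → H * N ^ j * V = 0 := by
    intro j hj
    ext a b
    rw [hE j (by omega), if_neg (by omega)]; rfl
  have hV1 : H * N ^ (k-1) * V = 1 := by
    ext a b
    rw [hE _ (by omega), if_pos rfl]
  let X := -(N ^ k * V)
  refine ⟨X, ?_⟩
  have hpow : ∀ j, j ≤ k - 1 → (N + X * H) ^ j * V = N ^ j * V := by
    intro j
    induction j with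
    | zero => intro _; simp
    | succ j ih =>
      intro hj
      rw [pow_succ', Matrix.mul_assoc, ih (by omega), Matrix.add_mul, Matrix.mul_assoc X,
        ← Matrix.mul_assoc H, hV j (by omega), Matrix.mul_zero, add_zero, ← Matrix.mul_assoc,
        ← pow_succ']
  apply nilp hk H _ V (obs_inj_ne H N X h)
  · intro j hj
    rw [Matrix.mul_assoc, hpow j (by omega), ← Matrix.mul_assoc, hV j hj]
  · rw [Matrix.mul_assoc, hpow _ le_rfl, ← Matrix.mul_assoc, hV1]
  · obtain ⟨m, rfl⟩ : ∃ m, k = m + 1 := ⟨k - 1, by omega⟩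
    simp only [Nat.add_sub_cancel] at *
    rw [pow_succ', Matrix.mul_assoc, hpow _ le_rfl, Matrix.add_mul, Matrix.mul_assoc X,
        ← Matrix.mul_assoc H, hV1, Matrix.mul_one, ← Matrix.mul_assoc, ← pow_succ']
    simp [X]

lemma trans_aux (hk : 1 ≤ k) (H H' : Matrix (Fin p) (Fin (k*p)) ℝ)
    (N N' : Matrix (Fin (k*p)) (Fin (k*p)) ℝ)
    (h : 0 < (obs H N).det * (obs H' N').det) :
    ∃ (X : Matrix (Fin (k*p)) (Fin p) ℝ) (U : Matrix (Fin (k*p)) (Fin (k*p)) ℝ),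
      0 < U.det ∧ (H', N') = (H * U⁻¹, U * N * U⁻¹ + X * H * U⁻¹) := by
  have h1 : (obs H N).det ≠ 0 := left_ne_zero_of_mul h.ne'
  have h2 : (obs H' N').det ≠ 0 := right_ne_zero_of_mul h.ne'
  obtain ⟨X, hX⟩ := exists_nilp hk H N h1
  obtain ⟨X', hX'⟩ := exists_nilp hk H' N' h2
  have s1 := obs_inj_sign H N X h1
  have s2 := obs_inj_sign H' N' X' h2
  have h3 := obs_inj_ne H' N' X' h2
  set M := N + X * H with hM
  set M' := N' + X' * H' with hM'
  set U := (obs H' M')⁻¹ * obs H M with hU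
  have hOU : obs H' M' * U = obs H M := by
    rw [hU, ← Matrix.mul_assoc, Matrix.mul_nonsing_inv _ (isUnit_iff_ne_zero.mpr h3),
      Matrix.one_mul]
  have hdet : 0 < U.det := by
    have e : (obs H' M').det * U.det = (obs H M).det := by rw [← Matrix.det_mul, hOU]
    rw [← e] at s1
    have : 0 < ((obs H N).det * (obs H' N').det) * ((obs H' M').det)^2 *
        ((obs H N).det * (obs H' N').det) * U.det := by
      have := mul_pos (mul_pos s1 s2) h
      nlinarith [mul_pos (mul_pos s1 s2) h]
    exact pos_of_mul_pos_right this (by positivity)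
  have hUu : IsUnit U.det := isUnit_iff_ne_zero.mpr hdet.ne'
  have hrow : ∀ j, j < k → H' * M' ^ j * U = H * M ^ j := by
    intro j hj
    ext a l
    rw [← obs_mul_apply H' M' U ⟨j, hj⟩ a l, hOU, obs_apply]
  have hH : H' * U = H := by simpa using hrow 0 (by omega)
  have hN : M' * U = U * M := by
    have : obs H' M' * (M' * U) = obs H' M' * (U * M) := by
      apply ext_row
      intro j a l
      rw [← Matrix.mul_assoc _ U M, hOU, obs_mul_apply, obs_mul_apply]
      have : H' * M' ^ (j:ℕ) * (M' * U) = H * M ^ (j:ℕ) * M := by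
        rw [← Matrix.mul_assoc, Matrix.mul_assoc H', ← pow_succ, Matrix.mul_assoc H, ← pow_succ]
        by_cases hj : (j:ℕ) + 1 < k
        · exact hrow _ hj
        · have : (j:ℕ) + 1 = k := by omega
          rw [this, hX, hX']; simp
      rw [this]
    have := congrArg (fun Z => (obs H' M')⁻¹ * Z) this
    simpa only [← Matrix.mul_assoc, Matrix.nonsing_inv_mul _ (isUnit_iff_ne_zero.mpr h3),
      Matrix.one_mul] using this
  have hH' : H' = H * U⁻¹ := by
    rw [← hH, Matrix.mul_assoc, Matrix.mul_nonsing_inv _ hUu, Matrix.mul_one]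
  have hN' : M' = U * M * U⁻¹ := by
    rw [← hN, Matrix.mul_assoc, Matrix.mul_nonsing_inv _ hUu, Matrix.mul_one]
  refine ⟨U * X - X', U, hdet, Prod.ext hH' ?_⟩
  have : N' = M' - X' * H' := by rw [hM']; abel
  change N' = _
  rw [this, hN', hH', hM]
  simp only [Matrix.mul_add, Matrix.add_mul, Matrix.sub_mul, Matrix.mul_assoc]
  abel

lemma orbit_form (H : Matrix (Fin p) (Fin (k*p)) ℝ)
    (N U : Matrix (Fin (k*p)) (Fin (k*p)) ℝ) (X : Matrix (Fin (k*p)) (Fin p) ℝ)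
    (hU : 0 < U.det) :
    (obs (H * U⁻¹) (U * N * U⁻¹ + X * H * U⁻¹)).det
      = (obs H (N + (U⁻¹ * X) * H)).det * (U.det)⁻¹ := by
  have hUu : IsUnit U.det := isUnit_iff_ne_zero.mpr hU.ne'
  have : U * N * U⁻¹ + X * H * U⁻¹ = U * (N + (U⁻¹ * X) * H) * U⁻¹ := by
    rw [Matrix.mul_add, Matrix.add_mul, ← Matrix.mul_assoc U, ← Matrix.mul_assoc U U⁻¹,
      Matrix.mul_nonsing_inv _ hUu, Matrix.one_mul]
  rw [this, obs_conj _ _ _ hUu, Matrix.det_mul, Matrix.det_nonsing_inv, Ring.inverse_eq_inv']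

lemma orbit_sign (H : Matrix (Fin p) (Fin (k*p)) ℝ)
    (N U : Matrix (Fin (k*p)) (Fin (k*p)) ℝ) (X : Matrix (Fin (k*p)) (Fin p) ℝ)
    (hU : 0 < U.det) (h : (obs H N).det ≠ 0) :
    0 < (obs H N).det * (obs (H * U⁻¹) (U * N * U⁻¹ + X * H * U⁻¹)).det := by
  rw [orbit_form _ _ _ _ hU, ← mul_assoc]
  exact mul_pos (obs_inj_sign _ _ _ h) (inv_pos.mpr hU)

lemma orbit_zero (H : Matrix (Fin p) (Fin (k*p)) ℝ)
    (N U : Matrix (Fin (k*p)) (Fin (k*p)) ℝ) (X : Matrix (Fin (k*p)) (Fin p) ℝ)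
    (hU : 0 < U.det) (h : (obs H N).det = 0) :
    (obs (H * U⁻¹) (U * N * U⁻¹ + X * H * U⁻¹)).det = 0 := by
  rw [orbit_form _ _ _ _ hU]
  by_contra hc
  have := obs_inj_ne H _ (-(U⁻¹ * X)) (left_ne_zero_of_mul hc)
  apply this
  rw [Matrix.neg_mul, add_neg_cancel_right, h]

lemma exists_base (hk : 1 ≤ k) : ∃ (H : Matrix (Fin p) (Fin (k*p)) ℝ)
    (N : Matrix (Fin (k*p)) (Fin (k*p)) ℝ), (obs H N).det = 1 := by
  let H : Matrix (Fin p) (Fin (k*p)) ℝ := Matrix.of fun a l =>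
    if finProdFinEquiv (⟨0, by omega⟩, a) = l then 1 else 0
  let N : Matrix (Fin (k*p)) (Fin (k*p)) ℝ := Matrix.of fun i l =>
    if ((finProdFinEquiv.symm i).1 : ℕ) + 1 = (finProdFinEquiv.symm l).1 ∧
      (finProdFinEquiv.symm i).2 = (finProdFinEquiv.symm l).2 then 1 else 0
  refine ⟨H, N, ?_⟩
  have key : ∀ j (hj : j < k) (a : Fin p) l, (H * N ^ j) a l =
      if finProdFinEquiv (⟨j, hj⟩, a) = l then 1 else 0 := by
    intro j
    induction j with
    | zero => intro hj a l; simp [H]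
    | succ j ih =>
      intro hj a l
      rw [pow_succ, ← Matrix.mul_assoc, Matrix.mul_apply]
      simp only [ih (by omega), ite_mul, one_mul, zero_mul, Finset.sum_ite_eq, Finset.mem_univ,
        if_true]
      obtain ⟨⟨j', b⟩, rfl⟩ := finProdFinEquiv.surjective l
      simp only [N, Matrix.of_apply, Equiv.symm_apply_apply, EmbeddingLike.apply_eq_iff_eq,
        Prod.mk.injEq, Fin.ext_iff]
  have : obs H N = 1 := by
    apply ext_row
    intro j a l
    rw [obs_apply, key j j.2, Matrix.one_apply]
  rw [this, Matrix.det_one]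

lemma exists_base_neg (hp : 1 ≤ p) (hk : 1 ≤ k) : ∃ (H : Matrix (Fin p) (Fin (k*p)) ℝ)
    (N : Matrix (Fin (k*p)) (Fin (k*p)) ℝ), (obs H N).det < 0 := by
  obtain ⟨H, N, h⟩ := exists_base (p := p) hk
  have hn : 0 < k * p := Nat.mul_pos hk hp
  let U : Matrix (Fin (k*p)) (Fin (k*p)) ℝ :=
    Matrix.diagonal (Function.update (fun _ => 1) ⟨0, hn⟩ (-1))
  have hU : U.det = -1 := by
    rw [Matrix.det_diagonal, Finset.prod_update_of_mem (Finset.mem_univ _)]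
    simp
  refine ⟨H * U⁻¹, U * N * U⁻¹, ?_⟩
  rw [obs_conj _ _ _ (by rw [hU]; simp), Matrix.det_mul, Matrix.det_nonsing_inv, hU, h,
    Ring.inverse_eq_inv']
  norm_num

open Polynomial in
lemma dense_aux (hk : 1 ≤ k) (H : Matrix (Fin p) (Fin (k*p)) ℝ)
    (N : Matrix (Fin (k*p)) (Fin (k*p)) ℝ)
    (S : Set (Matrix (Fin p) (Fin (k*p)) ℝ × Matrix (Fin (k*p)) (Fin (k*p)) ℝ))
    (hS : IsOpen S) (hm : (H, N) ∈ S) : ∃ q ∈ S, (obs q.1 q.2).det ≠ 0 := by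
  by_contra! hc
  obtain ⟨H₀, N₀, h₀⟩ := exists_base (p := p) hk
  let HP : Matrix (Fin p) (Fin (k*p)) ℝ[X] := Matrix.of fun i j =>
    Polynomial.C (H i j) + Polynomial.X * Polynomial.C (H₀ i j - H i j)
  let NP : Matrix (Fin (k*p)) (Fin (k*p)) ℝ[X] := Matrix.of fun i j =>
    Polynomial.C (N i j) + Polynomial.X * Polynomial.C (N₀ i j - N i j)
  have hev : ∀ t : ℝ, (obs HP NP).det.eval t =
      (obs (H + t • (H₀ - H)) (N + t • (N₀ - N))).det := by
    intro t
    have e := RingHom.map_det (Polynomial.evalRingHom t) (obs HP NP)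
    rw [RingHom.mapMatrix_apply, obs_map] at e
    rw [← Polynomial.coe_evalRingHom, e]
    congr 2 <;> ext i j <;> simp [HP, NP]
  have hcont : Continuous fun t : ℝ => (H + t • (H₀ - H), N + t • (N₀ - N)) := by
    refine Continuous.prodMk ?_ ?_
    · exact continuous_const.add (continuous_id.smul continuous_const)
    · exact continuous_const.add (continuous_id.smul continuous_const)
  have hnhds : (fun t : ℝ => (H + t • (H₀ - H), N + t • (N₀ - N))) ⁻¹' S ∈ nhds (0:ℝ) :=
    (hS.preimage hcont).mem_nhds (by simpa using hm)
  have hinf := infinite_of_mem_nhds (0:ℝ) hnhds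
  have hz : (obs HP NP).det = 0 := by
    apply Polynomial.eq_zero_of_infinite_isRoot
    refine hinf.mono fun t ht => ?_
    change (obs HP NP).det.eval t = 0
    rw [hev]
    exact hc _ ht
  have := hev 1
  rw [hz] at this
  simp [h₀] at this

end CoadjAux

/-- Over ℝ, the coadjoint action of the identity component
`G₀ = M_{n,p}(ℝ) ⋊ GL⁺(n,ℝ)` of `G_{n,p}(ℝ)` on `M_{p,n}(ℝ) × gl(n,ℝ)`, given by
`(X,U)·(H,N) = (H·U⁻¹, U·N·U⁻¹ + X·H·U⁻¹)`, has exactly two open orbits: there are two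
points with open, disjoint orbits, and every point with an open orbit lies in one of them. -/
theorem stmt11 (p k n : ℕ) (hp : 1 ≤ p) (hk : 1 ≤ k) (hn : n = k * p) :
    let orbit : (Matrix (Fin p) (Fin n) ℝ × Matrix (Fin n) (Fin n) ℝ) →
        Set (Matrix (Fin p) (Fin n) ℝ × Matrix (Fin n) (Fin n) ℝ) := fun q =>
      {q' | ∃ (X : Matrix (Fin n) (Fin p) ℝ) (U : Matrix (Fin n) (Fin n) ℝ),
        0 < U.det ∧ q' = (q.1 * U⁻¹, U * q.2 * U⁻¹ + X * q.1 * U⁻¹)}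
    ∃ q₁ q₂ : Matrix (Fin p) (Fin n) ℝ × Matrix (Fin n) (Fin n) ℝ,
      IsOpen (orbit q₁) ∧ IsOpen (orbit q₂) ∧ orbit q₁ ∩ orbit q₂ = ∅ ∧
      ∀ q, IsOpen (orbit q) → q ∈ orbit q₁ ∨ q ∈ orbit q₂ := by
  subst hn
  intro orbit
  obtain ⟨H₁, N₁, h₁⟩ := CoadjAux.exists_base (p := p) hk
  obtain ⟨H₂, N₂, h₂⟩ := CoadjAux.exists_base_neg hp hk
  have o1 : orbit (H₁, N₁) = {q | 0 < (CoadjAux.obs q.1 q.2).det} := by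
    ext ⟨H, N⟩
    constructor
    · rintro ⟨X, U, hU, e⟩
      rw [Set.mem_setOf_eq, e]
      have := CoadjAux.orbit_sign H₁ N₁ U X hU (by rw [h₁]; norm_num)
      rwa [h₁, one_mul] at this
    · intro h
      exact CoadjAux.trans_aux hk H₁ H N₁ N (by rw [h₁, one_mul]; exact h)
  have o2 : orbit (H₂, N₂) = {q | (CoadjAux.obs q.1 q.2).det < 0} := by
    ext ⟨H, N⟩
    constructor
    · rintro ⟨X, U, hU, e⟩
      rw [Set.mem_setOf_eq, e]
      exact neg_of_mul_pos_right (CoadjAux.orbit_sign H₂ N₂ U X hU h₂.ne) h₂.le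
    · intro h
      exact CoadjAux.trans_aux hk H₂ H N₂ N (mul_pos_of_neg_of_neg h₂ h)
  refine ⟨(H₁, N₁), (H₂, N₂), ?_, ?_, ?_, ?_⟩
  · rw [o1]; exact isOpen_lt continuous_const CoadjAux.obs_cont
  · rw [o2]; exact isOpen_lt CoadjAux.obs_cont continuous_const
  · rw [o1, o2]
    ext q
    simp only [Set.mem_inter_iff, Set.mem_setOf_eq, Set.mem_empty_iff_false, iff_false, not_and]
    intro h; exact not_lt.mpr h.le
  · rintro ⟨H, N⟩ hq
    rw [o1, o2]
    rcases lt_trichotomy (CoadjAux.obs H N).det 0 with h | h | h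
    · exact Or.inr h
    · exfalso
      have hm : (H, N) ∈ orbit (H, N) := ⟨0, 1, by simp, by simp⟩
      obtain ⟨q, ⟨X, U, hU, e⟩, hne⟩ := CoadjAux.dense_aux hk H N _ hq hm
      apply hne
      rw [e]
      exact CoadjAux.orbit_zero H N U X hU h
    · exact Or.inl h
end

section
/- Over ℂ, the coadjoint action of G_{n,p}(ℂ) has exactly one open orbit: for the action (X,U)·(H,N) = (H·U⁻¹, U·N·U⁻¹ + X·H·U⁻¹) of G_{n,p}(ℂ) = M_{n,p}(ℂ) ⋊ GL(n,ℂ) on M_{p,n}(ℂ) × gl(n,ℂ), there exists a point whose orbit is open, and any two points whose orbits are open lie in the same orbit. -/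
open Matrix

namespace S12

abbrev Pt (p n : ℕ) := Matrix (Fin p) (Fin n) ℂ × Matrix (Fin n) (Fin n) ℂ

def Rel {p n : ℕ} (q q' : Pt p n) : Prop :=
  ∃ (X : Matrix (Fin n) (Fin p) ℂ) (U : GL (Fin n) ℂ),
    q' = (q.1 * (U⁻¹).val, U.val * q.2 * (U⁻¹).val + X * q.1 * (U⁻¹).val)

lemma Rel.refl {p n : ℕ} (q : Pt p n) : Rel q q := ⟨0, 1, by simp⟩

lemma Rel.symm {p n : ℕ} {q q' : Pt p n} (h : Rel q q') : Rel q' q := by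
  obtain ⟨X, U, rfl⟩ := h
  refine ⟨-((U⁻¹).val * X), U⁻¹, ?_⟩
  have h1 : (U⁻¹).val * U.val = 1 := U.inv_mul
  refine Prod.ext ?_ ?_
  · simp only [inv_inv, Matrix.mul_assoc, h1, Matrix.mul_one]
  · simp only [inv_inv, Matrix.mul_assoc, Matrix.mul_add, Matrix.add_mul, h1, Matrix.mul_one,
      Matrix.neg_mul]
    rw [← Matrix.mul_assoc, h1]
    simp

lemma Rel.trans {p n : ℕ} {q q' q'' : Pt p n} (h : Rel q q') (h' : Rel q' q'') : Rel q q'' := by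
  obtain ⟨X, U, rfl⟩ := h
  obtain ⟨Y, V, rfl⟩ := h'
  refine ⟨V.val * X + Y, V * U, ?_⟩
  refine Prod.ext ?_ ?_
  · simp only [_root_.mul_inv_rev, Units.val_mul, Matrix.mul_assoc]
  · simp only [_root_.mul_inv_rev, Units.val_mul, Matrix.mul_assoc, Matrix.mul_add, Matrix.add_mul,
      add_assoc]

def P {p n : ℕ} (k : ℕ) (q : Pt p n) : Prop :=
  ∀ v : Fin n → ℂ, (∀ i < k, (q.1 * q.2 ^ i) *ᵥ v = 0) → v = 0

lemma P_of_rel {p n k : ℕ} {q q' : Pt p n} (h : Rel q q') (hq : P k q) : P k q' := by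
  obtain ⟨X, U, rfl⟩ := h
  obtain ⟨H, N⟩ := q
  intro v hv
  simp only at hv
  have h1 : (U⁻¹).val * U.val = 1 := U.inv_mul
  have h2 : U.val * (U⁻¹).val = 1 := U.mul_inv
  set N' := U.val * N * (U⁻¹).val + X * H * (U⁻¹).val with hN'
  have key : ∀ i ≤ k, N' ^ i *ᵥ v = (U.val * N ^ i * (U⁻¹).val) *ᵥ v := by
    intro i
    induction i with
    | zero => intro _; simp [h2]
    | succ i ih =>
      intro hi
      have e := ih (by omega)
      have z := hv i (by omega)
      rw [← Matrix.mulVec_mulVec, e, Matrix.mulVec_mulVec] at z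
      have z' : (H * N ^ i * (U⁻¹).val) *ᵥ v = 0 := by
        rw [← z]; congr 1
        simp only [Matrix.mul_assoc]
        rw [← Matrix.mul_assoc (U⁻¹).val U.val, h1, Matrix.one_mul]
      rw [pow_succ', ← Matrix.mulVec_mulVec, e, Matrix.mulVec_mulVec]
      have : N' * (U.val * N ^ i * (U⁻¹).val)
          = U.val * N ^ (i+1) * (U⁻¹).val + X * (H * N ^ i * (U⁻¹).val) := by
        rw [hN', Matrix.add_mul, pow_succ']
        simp only [Matrix.mul_assoc]
        rw [← Matrix.mul_assoc (U⁻¹).val U.val, h1, Matrix.one_mul]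
      rw [this, Matrix.add_mulVec, ← Matrix.mulVec_mulVec v X, z']
      simp
  have : (U⁻¹).val *ᵥ v = 0 := by
    apply hq
    intro i hi
    have z := hv i hi
    rw [← Matrix.mulVec_mulVec, key i hi.le, Matrix.mulVec_mulVec] at z
    rw [Matrix.mulVec_mulVec, ← z]; congr 1
    simp only [Matrix.mul_assoc]
    rw [← Matrix.mul_assoc (U⁻¹).val U.val, h1, Matrix.one_mul]
  have h3 : U.val *ᵥ ((U⁻¹).val *ᵥ v) = v := by rw [Matrix.mulVec_mulVec, h2, Matrix.one_mulVec]
  rw [← h3, this, Matrix.mulVec_zero]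

/-- stack of blocks -/
def stk {p k n : ℕ} {β : Type} (e : Fin k × Fin p ≃ Fin n) (V : ℕ → Matrix (Fin p) β ℂ) :
    Matrix (Fin n) β ℂ :=
  Matrix.of fun a b => V (e.symm a).1 (e.symm a).2 b

lemma stk_mulVec {p k n : ℕ} (e : Fin k × Fin p ≃ Fin n) (V : ℕ → Matrix (Fin p) (Fin n) ℂ)
    (v : Fin n → ℂ) : stk e V *ᵥ v = 0 ↔ ∀ i < k, V i *ᵥ v = 0 := by
  constructor
  · intro h i hi
    ext r
    have := congrFun h (e (⟨i, hi⟩, r))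
    simpa [stk, Matrix.mulVec, dotProduct] using this
  · intro h
    ext a
    have := congrFun (h (e.symm a).1 (e.symm a).1.2) (e.symm a).2
    simpa [stk, Matrix.mulVec, dotProduct] using this

lemma stk_det {p k n : ℕ} (e : Fin k × Fin p ≃ Fin n) (V : ℕ → Matrix (Fin p) (Fin n) ℂ) :
    (stk e V).det ≠ 0 ↔ ∀ v : Fin n → ℂ, (∀ i < k, V i *ᵥ v = 0) → v = 0 := by
  rw [Ne, ← Matrix.exists_mulVec_eq_zero_iff]
  push Not
  constructor
  · intro h v hv
    by_contra h0
    exact h v h0 ((stk_mulVec e V v).2 hv)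
  · intro h v h0 hv
    exact h0 (h v ((stk_mulVec e V v).1 hv))

def J {p k n : ℕ} (e : Fin k × Fin p ≃ Fin n) : Matrix (Fin n) (Fin n) ℂ :=
  Matrix.of fun a b => if h : ((e.symm a).1 : ℕ) + 1 < k then
    (1 : Matrix (Fin n) (Fin n) ℂ) (e (⟨_, h⟩, (e.symm a).2)) b else 0

def E {p k n : ℕ} (hk : 1 ≤ k) (e : Fin k × Fin p ≃ Fin n) : Matrix (Fin p) (Fin n) ℂ :=
  Matrix.of fun r b => (1 : Matrix (Fin n) (Fin n) ℂ) (e (⟨0, hk⟩, r)) b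

lemma J_mul {p k n : ℕ} (e : Fin k × Fin p ≃ Fin n) (V : ℕ → Matrix (Fin p) (Fin n) ℂ)
    (hV : V k = 0) : J e * stk e V = stk e (fun i => V (i+1)) := by
  ext a b
  rw [Matrix.mul_apply]
  by_cases h : ((e.symm a).1 : ℕ) + 1 < k
  · simp [J, stk, h, Matrix.one_apply]
  · have : ((e.symm a).1 : ℕ) + 1 = k := by have := (e.symm a).1.2; omega
    simp [J, stk, this, hV]

lemma E_mul {p k n : ℕ} (hk : 1 ≤ k) (e : Fin k × Fin p ≃ Fin n)
    (V : ℕ → Matrix (Fin p) (Fin n) ℂ) : E hk e * stk e V = V 0 := by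
  ext a b
  rw [Matrix.mul_apply]
  simp [E, stk, Matrix.one_apply]

lemma EJ_pow {p k n : ℕ} (hk : 1 ≤ k) (e : Fin k × Fin p ≃ Fin n) (i : ℕ) (hi : i < k)
    (r : Fin p) (b : Fin n) : (E hk e * J e ^ i) r b
      = (1 : Matrix (Fin n) (Fin n) ℂ) (e (⟨i, hi⟩, r)) b := by
  induction i generalizing b with
  | zero => simp [E]
  | succ i ih =>
    rw [pow_succ, ← Matrix.mul_assoc, Matrix.mul_apply]
    simp only [ih (by omega)]
    rw [Finset.sum_eq_single (e (⟨i, by omega⟩, r))]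
    · simp [J, hi]
      refine congrArg (fun z => (1 : Matrix (Fin n) (Fin n) ℂ) (e z) b) ?_
      ext <;> simp
    · intro x _ hx
      rw [Matrix.one_apply_ne hx.symm, zero_mul]
    · simp

lemma P_EJ {p k n : ℕ} (hk : 1 ≤ k) (e : Fin k × Fin p ≃ Fin n) : P k (E hk e, J e) := by
  intro v hv
  ext a
  have h := congrFun (hv (e.symm a).1 (e.symm a).1.2) (e.symm a).2
  simp only [Matrix.mulVec, dotProduct, EJ_pow hk e _ (e.symm a).1.2] at h
  simpa [Matrix.one_apply] using h

def VV {p n : ℕ} (H : Matrix (Fin p) (Fin n) ℂ) (N : Matrix (Fin n) (Fin n) ℂ)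
    (Xs : ℕ → Matrix (Fin p) (Fin p) ℂ) : ℕ → Matrix (Fin p) (Fin n) ℂ
  | 0 => H
  | i+1 => VV H N Xs i * N + Xs i * H

lemma VV_eq {p n : ℕ} (H : Matrix (Fin p) (Fin n) ℂ) (N : Matrix (Fin n) (Fin n) ℂ)
    (Xs : ℕ → Matrix (Fin p) (Fin p) ℂ) (i : ℕ) :
    VV H N Xs i = H * N ^ i + ∑ j ∈ Finset.range i, Xs j * (H * N ^ (i - 1 - j)) := by
  induction i with
  | zero => simp [VV]
  | succ i ih =>
    rw [VV, ih, Finset.sum_range_succ, Matrix.add_mul, Matrix.sum_mul, pow_succ, Matrix.mul_assoc,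
      add_assoc]
    congr 2
    · refine Finset.sum_congr rfl fun j hj => ?_
      have := Finset.mem_range.1 hj
      have e : i + 1 - 1 - j = (i - 1 - j) + 1 := by omega
      rw [e, pow_succ]
      simp only [Matrix.mul_assoc]
    · simp

lemma VV_ker {p n k : ℕ} (H : Matrix (Fin p) (Fin n) ℂ) (N : Matrix (Fin n) (Fin n) ℂ)
    (Xs : ℕ → Matrix (Fin p) (Fin p) ℂ) (v : Fin n → ℂ)
    (h : ∀ i < k, VV H N Xs i *ᵥ v = 0) : ∀ i < k, (H * N ^ i) *ᵥ v = 0 := by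
  intro i
  induction i using Nat.strong_induction_on with
  | _ i ih =>
    intro hi
    have h1 := h i hi
    rw [VV_eq, Matrix.add_mulVec, Matrix.sum_mulVec, Finset.sum_eq_zero, add_zero] at h1
    · exact h1
    · intro j hj
      have := Finset.mem_range.1 hj
      rw [← Matrix.mulVec_mulVec, ih _ (by omega) (by omega), Matrix.mulVec_zero]

lemma exists_Xs {p k n : ℕ} (e : Fin k × Fin p ≃ Fin n) (H : Matrix (Fin p) (Fin n) ℂ)
    (N : Matrix (Fin n) (Fin n) ℂ) (hP : P k (H, N)) :
    ∃ Xs : ℕ → Matrix (Fin p) (Fin p) ℂ, VV H N Xs k = 0 := by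
  have hd := (stk_det e (fun i => H * N ^ i)).2 hP
  set O := stk e (fun i => H * N ^ i) with hO
  set Y : Matrix (Fin p) (Fin n) ℂ := -(H * N ^ k) * O⁻¹ with hY
  have hYO : Y * O = -(H * N ^ k) := by
    rw [hY, Matrix.mul_assoc, Matrix.nonsing_inv_mul _ (isUnit_iff_ne_zero.2 hd), Matrix.mul_one]
  refine ⟨fun j => if h : k - 1 - j < k then
    Matrix.of fun r s => Y r (e (⟨k - 1 - j, h⟩, s)) else 0, ?_⟩
  rw [VV_eq, ← neg_neg (H * N ^ k), ← hYO, neg_add_eq_zero, ← Finset.sum_range_reflect]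
  ext r b
  rw [Matrix.mul_apply, ← e.sum_comp, Fintype.sum_prod_type, Matrix.sum_apply,
    ← Fin.sum_univ_eq_sum_range (fun j => _)]
  refine Finset.sum_congr rfl fun j _ => ?_
  have hj := j.2
  have e1 : k - 1 - (k - 1 - (j : ℕ)) = j := by omega
  rw [Matrix.mul_apply]
  refine Finset.sum_congr rfl fun s _ => ?_
  simp [e1, hO, stk]

lemma rel_EJ {p k n : ℕ} (hk : 1 ≤ k) (e : Fin k × Fin p ≃ Fin n) (q : Pt p n) (hP : P k q) :
    Rel q (E hk e, J e) := by
  obtain ⟨H, N⟩ := q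
  obtain ⟨Xs, hX⟩ := exists_Xs e H N hP
  have hd : (stk e (VV H N Xs)).det ≠ 0 :=
    (stk_det e _).2 fun v hv => hP v (VV_ker H N Xs v hv)
  let U : GL (Fin n) ℂ := Matrix.GeneralLinearGroup.mkOfDetNeZero _ hd
  have hU : U.val = stk e (VV H N Xs) := rfl
  have h2 : U.val * (U⁻¹).val = 1 := U.mul_inv
  refine ⟨stk e Xs, U, Prod.ext ?_ ?_⟩
  · have : H = E hk e * U.val := by rw [hU, E_mul]; rfl
    change E hk e = H * (U⁻¹).val
    conv_rhs => rw [this, Matrix.mul_assoc, h2, Matrix.mul_one]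
  · change J e = U.val * N * (U⁻¹).val + stk e Xs * H * (U⁻¹).val
    have : U.val * N + stk e Xs * H = J e * U.val := by
      rw [hU, J_mul e _ hX]
      ext a b
      simp [stk, VV, Matrix.mul_apply]
    rw [← Matrix.add_mul, this, Matrix.mul_assoc, h2, Matrix.mul_one]

lemma isOpen_P {p k n : ℕ} (e : Fin k × Fin p ≃ Fin n) : IsOpen {q : Pt p n | P k q} := by
  have : {q : Pt p n | P k q} = {q | (stk e (fun i => q.1 * q.2 ^ i)).det ≠ 0} := by
    ext q; exact (stk_det e _).symm
  rw [this]
  refine isOpen_ne_fun ?_ continuous_const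
  refine Continuous.matrix_det ?_
  refine continuous_matrix fun a b => ?_
  have : Continuous fun q : Pt p n => q.1 * q.2 ^ ((e.symm a).1 : ℕ) :=
    continuous_fst.matrix_mul (continuous_snd.pow _)
  exact this.matrix_elem _ _

lemma dense_P {p k n : ℕ} (hk : 1 ≤ k) (e : Fin k × Fin p ≃ Fin n) (q : Pt p n)
    (S : Set (Pt p n)) (hS : IsOpen S) (hq : q ∈ S) : ∃ s ∈ S, P k s := by
  by_contra hcon
  push Not at hcon
  set s0 : Pt p n := (E hk e, J e) with hs0
  let L : ℂ → Pt p n := fun t => q + t • (s0 - q)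
  have hL : Continuous L := by fun_prop
  let f : ℂ → ℂ := fun t => (stk e (fun i => (L t).1 * (L t).2 ^ i)).det
  have hf : Differentiable ℂ f := by
    have h1 : ∀ r b, Differentiable ℂ fun t => (L t).1 r b := by
      intro r b
      change Differentiable ℂ fun t => q.1 r b + t * (s0.1 r b - q.1 r b)
      fun_prop
    have h2 : ∀ r b, Differentiable ℂ fun t => (L t).2 r b := by
      intro r b
      change Differentiable ℂ fun t => q.2 r b + t * (s0.2 r b - q.2 r b)
      fun_prop
    have h3 : ∀ (i : ℕ) r b, Differentiable ℂ fun t => ((L t).1 * (L t).2 ^ i) r b := by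
      intro i
      induction i with
      | zero => simpa using h1
      | succ i ih =>
        intro r b
        have hh : (fun t => ((L t).1 * (L t).2 ^ (i + 1)) r b)
            = fun t => ∑ c, ((L t).1 * (L t).2 ^ i) r c * (L t).2 c b := by
          funext t
          rw [pow_succ, ← Matrix.mul_assoc, Matrix.mul_apply]
        rw [hh]
        exact Differentiable.fun_sum fun c _ => (ih r c).mul (h2 c b)
    simp only [f, Matrix.det_apply']
    refine Differentiable.fun_sum fun σ _ => Differentiable.const_mul ?_ _
    refine Differentiable.fun_finsetProd fun c _ => ?_
    exact h3 _ _ _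
  have hz : f =ᶠ[nhds 0] 0 := by
    have : ∀ᶠ t in nhds (0:ℂ), L t ∈ S := hL.continuousAt.eventually_mem
      (hS.mem_nhds (by simpa [L] using hq))
    filter_upwards [this] with t ht
    by_contra h
    exact hcon _ ht ((stk_det e _).1 h)
  have hA : AnalyticOnNhd ℂ f Set.univ := fun t _ => hf.analyticAt t
  have h1 := hA.eqOn_zero_of_preconnected_of_eventuallyEq_zero isPreconnected_univ
    (Set.mem_univ 0) hz (Set.mem_univ 1)
  have h2 : f 1 ≠ 0 := by
    have hL1 : L 1 = s0 := by simp [L]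
    simp only [f, hL1]
    exact (stk_det e _).2 (P_EJ hk e)
  exact h2 h1

end S12

/-- Over ℂ, the coadjoint action of `G_{n,p}(ℂ) = M_{n,p}(ℂ) ⋊ GL(n,ℂ)` on
`M_{p,n}(ℂ) × gl(n,ℂ)`, given by `(X,U)·(H,N) = (H·U⁻¹, U·N·U⁻¹ + X·H·U⁻¹)`, has exactly
one open orbit: there is a point with open orbit, and any two points with open orbits lie
in the same orbit. -/
theorem stmt12 (p k n : ℕ) (hp : 1 ≤ p) (hk : 1 ≤ k) (hn : n = k * p) :
    let orbit : (Matrix (Fin p) (Fin n) ℂ × Matrix (Fin n) (Fin n) ℂ) →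
        Set (Matrix (Fin p) (Fin n) ℂ × Matrix (Fin n) (Fin n) ℂ) := fun q =>
      {q' | ∃ (X : Matrix (Fin n) (Fin p) ℂ) (U : GL (Fin n) ℂ),
        q' = (q.1 * (U⁻¹).val, U.val * q.2 * (U⁻¹).val + X * q.1 * (U⁻¹).val)}
    (∃ q₀ : Matrix (Fin p) (Fin n) ℂ × Matrix (Fin n) (Fin n) ℂ, IsOpen (orbit q₀)) ∧
    ∀ q q' : Matrix (Fin p) (Fin n) ℂ × Matrix (Fin n) (Fin n) ℂ,
      IsOpen (orbit q) → IsOpen (orbit q') → q' ∈ orbit q := by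
  intro orbit
  have ho : ∀ q q', q' ∈ orbit q ↔ S12.Rel q q' := fun q q' => Iff.rfl
  let e : Fin k × Fin p ≃ Fin n := finProdFinEquiv.trans (finCongr hn.symm)
  have key : ∀ q, IsOpen (orbit q) → S12.Rel q (S12.E hk e, S12.J e) := by
    intro q hq
    obtain ⟨s, hs, hP⟩ := S12.dense_P hk e q (orbit q) hq (S12.Rel.refl q)
    exact S12.Rel.trans hs (S12.rel_EJ hk e s hP)
  refine ⟨⟨(S12.E hk e, S12.J e), ?_⟩, fun q q' h h' => ?_⟩
  · have : orbit (S12.E hk e, S12.J e) = {q | S12.P k q} := by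
      ext q
      exact ⟨fun h => S12.P_of_rel h (S12.P_EJ hk e), fun h => (S12.rel_EJ hk e q h).symm⟩
    rw [this]
    exact S12.isOpen_P e
  · exact (key q h).trans (key q' h').symm
end

section
/- (i) For every (H,M) ∈ M_{p,n}(𝕂) × gl(n,𝕂) there exists U ∈ GL(n,𝕂) and A ∈ M_p(𝕂) such that H·U⁻¹ is the block row (0, …, 0, A) (all p×p blocks zero except the last). (ii) If moreover the orbit of (H,M) under the coadjoint action of G_{n,p}(𝕂) is an open subset of M_{p,n}(𝕂) × gl(n,𝕂), then there exist (X,U) ∈ G_{n,p}(𝕂) and M' ∈ gl(n,𝕂) such that (X,U)·(H,M) = (H₀, M'). -/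
open Matrix

theorem aux_ext {K V : Type*} [Field K] [AddCommGroup V] [Module K V] [FiniteDimensional K V]
    {r : ℕ} (w : Fin r → V) (hw : LinearIndependent K w) (d : ℕ) (hd : r ≤ d)
    (hV : d ≤ Module.finrank K V) :
    ∃ w' : Fin d → V, LinearIndependent K w' ∧ Set.range w ⊆ Set.range w' := by
  induction d, hd using Nat.le_induction with
  | base => exact ⟨w, hw, subset_rfl⟩
  | succ d hd ih =>
    obtain ⟨w', h1, h2⟩ := ih (by omega)
    obtain ⟨x, hx⟩ := exists_linearIndependent_snoc_of_lt_finrank h1 (by omega)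
    refine ⟨_, hx, h2.trans ?_⟩
    rintro _ ⟨i, rfl⟩
    exact ⟨i.castSucc, by simp⟩

theorem aux_factor {K : Type} [RCLike K] {p n : ℕ} (hpn : p ≤ n)
    (H : Matrix (Fin p) (Fin n) K) :
    ∃ (A : Matrix (Fin p) (Fin p) K) (B : Matrix (Fin p) (Fin n) K),
      LinearIndependent K B.row ∧ H = A * B := by
  let S := Submodule.span K (Set.range H.row)
  have hS : Module.finrank K S ≤ p := by
    have := finrank_range_le_card (R := K) H.row
    rwa [Fintype.card_fin] at this
  let b := Module.finBasis K S
  have hb : LinearIndependent K (fun i => (b i : Fin n → K)) :=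
    b.linearIndependent.map' S.subtype (Submodule.ker_subtype S)
  obtain ⟨w, hw, hsub⟩ := aux_ext _ hb p hS (by simpa using hpn)
  have hmem : ∀ i, H.row i ∈ Submodule.span K (Set.range w) := by
    intro i
    have h1 : H.row i ∈ S := Submodule.subset_span ⟨i, rfl⟩
    refine Submodule.span_mono hsub ?_
    have h2 := b.sum_repr ⟨H.row i, h1⟩
    have h3 := congrArg Subtype.val h2
    simp only [Submodule.coe_sum, Submodule.coe_smul] at h3
    rw [← h3]
    exact Submodule.sum_mem _ fun j _ => Submodule.smul_mem _ _ (Submodule.subset_span ⟨j, rfl⟩)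
  simp only [Submodule.mem_span_range_iff_exists_fun] at hmem
  choose c hc using hmem
  refine ⟨Matrix.of c, Matrix.of w, hw, ?_⟩
  ext i j
  have := congrFun (hc i) j
  simp only [Finset.sum_apply, Pi.smul_apply, smul_eq_mul, Matrix.row] at this
  rw [← this, Matrix.mul_apply]
  rfl

theorem aux_H0 {K : Type} [RCLike K] {p n : ℕ} (hpn : p ≤ n)
    (B : Matrix (Fin p) (Fin n) K) (hB : LinearIndependent K B.row) :
    ∃ V : GL (Fin n) K, B = H0 K n p * V.val := by
  obtain ⟨w, hw, hsub⟩ := aux_ext _ hB n hpn (by simp)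
  choose f hf using fun i => hsub ⟨i, rfl⟩
  have hfi : Function.Injective f := fun i j h => hB.injective (by rw [← hf, ← hf, h])
  let g : Fin p → Fin n := fun i => ⟨n - p + i, by omega⟩
  have hg : Function.Injective g := fun i j h => by
    have := congrArg Fin.val h
    simp only [g] at this
    ext; omega
  obtain ⟨e, he⟩ : ∃ e : Equiv.Perm (Fin n), ∀ i, e (g i) = f i := by
    let e0 := (Equiv.ofInjective g hg).symm.trans (Equiv.ofInjective f hfi)
    refine ⟨e0.extendSubtype, fun i => ?_⟩
    rw [Equiv.extendSubtype_apply_of_mem e0 (g i) ⟨i, rfl⟩]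
    simp [e0]
  have hV : IsUnit (Matrix.of (w ∘ e)) := by
    rw [← Matrix.linearIndependent_rows_iff_isUnit]
    exact hw.comp e e.injective
  obtain ⟨V, hV⟩ := hV
  refine ⟨V, ?_⟩
  rw [hV]
  ext i j
  rw [Matrix.mul_apply, Finset.sum_eq_single (g i)]
  · have h1 := congrFun (hf i) j
    simp only [Matrix.row] at h1
    simp [H0, g, ← h1, ← he]
  · intro b _ hb
    have : ¬ ((b : ℕ) = n - p + (i : ℕ)) := fun h => hb (Fin.ext h)
    simp [H0, this]
  · simp

theorem aux_t {K : Type} [RCLike K] {p : ℕ} (A : Matrix (Fin p) (Fin p) K) (S : Set K)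
    (hS : S ∈ nhds (0 : K)) : ∃ t ∈ S, IsUnit (A + Matrix.scalar (Fin p) t) := by
  have hinf := infinite_of_mem_nhds (0 : K) hS
  obtain ⟨t, ht, hr⟩ := hinf.exists_notMem_finset (-A).charpoly.roots.toFinset
  refine ⟨t, ht, ?_⟩
  rw [Matrix.isUnit_iff_isUnit_det, isUnit_iff_ne_zero]
  intro h0
  apply hr
  rw [Multiset.mem_toFinset, Polynomial.mem_roots (Matrix.charpoly_monic _).ne_zero,
    Polynomial.IsRoot, Matrix.eval_charpoly, sub_neg_eq_add, add_comm, h0]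

/-- (i) every `(H,M) ∈ M_{p,n}(𝕂) × gl(n,𝕂)` can be moved by the coadjoint
action so that its first component becomes a block row `(0,…,0,A) = A·H₀`;
(ii) if the coadjoint orbit of `(H,M)` is open, `(H,M)` can be moved to some `(H₀,M')`. -/
theorem stmt14 (𝕂 : Type) [RCLike 𝕂] (p k n : ℕ) (hp : 1 ≤ p) (hk : 1 ≤ k)
    (hn : n = k * p)
    (H : Matrix (Fin p) (Fin n) 𝕂) (M : Matrix (Fin n) (Fin n) 𝕂) :
    -- (i)
    (∃ (U : GL (Fin n) 𝕂) (A : Matrix (Fin p) (Fin p) 𝕂),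
      H * (U⁻¹).val = A * H0 𝕂 n p) ∧
    -- (ii)
    (IsOpen {q : Matrix (Fin p) (Fin n) 𝕂 × Matrix (Fin n) (Fin n) 𝕂 |
        ∃ (X : Matrix (Fin n) (Fin p) 𝕂) (U : GL (Fin n) 𝕂),
          q = (H * (U⁻¹).val, U.val * M * (U⁻¹).val + X * H * (U⁻¹).val)} →
      ∃ (X : Matrix (Fin n) (Fin p) 𝕂) (U : GL (Fin n) 𝕂) (M' : Matrix (Fin n) (Fin n) 𝕂),
        ((H * (U⁻¹).val, U.val * M * (U⁻¹).val + X * H * (U⁻¹).val) :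
            Matrix (Fin p) (Fin n) 𝕂 × Matrix (Fin n) (Fin n) 𝕂)
          = (H0 𝕂 n p, M')) := by
  have hpn : p ≤ n := by rw [hn]; exact Nat.le_mul_of_pos_left p hk
  obtain ⟨A, B, hB, hH⟩ := aux_factor hpn H
  refine ⟨?_, ?_⟩
  · obtain ⟨V, hV⟩ := aux_H0 hpn B hB
    refine ⟨V, A, ?_⟩
    rw [hH, hV, Matrix.mul_assoc, Matrix.mul_assoc, ← Units.val_mul]
    simp
  · intro ho
    have hc : Continuous (fun t : 𝕂 => ((A + Matrix.scalar (Fin p) t) * B, M)) := by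
      refine Continuous.prodMk ?_ continuous_const
      refine Continuous.matrix_mul (continuous_const.add ?_) continuous_const
      exact Continuous.matrix_diagonal (continuous_pi fun _ => continuous_id)
    have hS := (ho.preimage hc).mem_nhds (x := 0) (by
      refine ⟨0, 1, ?_⟩
      simp [hH])
    obtain ⟨t, ⟨X, U, hq⟩, hu⟩ := aux_t A _ hS
    have h1 : (A + Matrix.scalar (Fin p) t) * B = H * (U⁻¹).val := congrArg Prod.fst hq
    have hHi : LinearIndependent 𝕂 H.row := by
      rw [← Matrix.vecMul_injective_iff] at hB ⊢
      intro v w hvw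
      have h2 : v ᵥ* (H * (U⁻¹).val) = w ᵥ* (H * (U⁻¹).val) := by
        rw [← Matrix.vecMul_vecMul, ← Matrix.vecMul_vecMul]
        exact congrArg (· ᵥ* (U⁻¹).val) hvw
      rw [← h1, ← Matrix.vecMul_vecMul, ← Matrix.vecMul_vecMul] at h2
      exact Matrix.vecMul_injective_of_isUnit hu (hB h2)
    obtain ⟨V, hV⟩ := aux_H0 hpn H hHi
    refine ⟨0, V, _, Prod.ext ?_ rfl⟩
    change H * (V⁻¹).val = _
    rw [hV, Matrix.mul_assoc, ← Units.val_mul]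
    simp
end

section
/- Let n > p (i.e. k ≥ 2) and let M' = [[M₁, 0],[H₁, 0]] and P' = [[P₁, 0],[K₁, 0]] in gl(n,𝕂) (block decomposition with M₁, P₁ ∈ gl(n−p,𝕂), H₁, K₁ ∈ M_{p,n−p}(𝕂), and last p columns zero). Then (H₀, M') and (H₀, P') lie in the same orbit of the coadjoint action of G_{n,p}(𝕂) on M_{p,n}(𝕂) × gl(n,𝕂) if and only if (H₁, M₁) and (K₁, P₁) lie in the same orbit of the coadjoint action of G_{n−p,p}(𝕂) on M_{p,n−p}(𝕂) × gl(n−p,𝕂). -/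
open Matrix

lemma aux_iff {𝕂 : Type} [RCLike 𝕂] {n p : ℕ} (U : GL (Fin n) 𝕂)
    (A D : Matrix (Fin p) (Fin n) 𝕂) (B C E : Matrix (Fin n) (Fin n) 𝕂) :
    ((A * (U⁻¹).val, B * (U⁻¹).val + C * (U⁻¹).val) :
      Matrix (Fin p) (Fin n) 𝕂 × Matrix (Fin n) (Fin n) 𝕂) = (D, E) ↔
    A = D * U.val ∧ B + C = E * U.val := by
  have h1 : (U⁻¹).val * U.val = 1 := by simp
  have h2 : U.val * (U⁻¹).val = 1 := by simp
  rw [Prod.mk.injEq, ← Matrix.add_mul]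
  constructor
  · rintro ⟨rfl, rfl⟩
    constructor <;> rw [Matrix.mul_assoc, h1, Matrix.mul_one]
  · rintro ⟨rfl, h⟩
    rw [h]
    constructor <;> rw [Matrix.mul_assoc, h2, Matrix.mul_one]

lemma H0_eq (𝕂 : Type) [RCLike 𝕂] (m p : ℕ) :
    H0 𝕂 (m + p) p = Matrix.reindex (Equiv.refl _) finSumFinEquiv
      (Matrix.fromCols (0 : Matrix (Fin p) (Fin m) 𝕂) (1 : Matrix (Fin p) (Fin p) 𝕂)) := by
  ext i j
  obtain ⟨j, rfl⟩ := finSumFinEquiv.surjective j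
  rcases j with j | j
  · have : (j : ℕ) ≠ m + i := by omega
    simp [H0, this]
  · simp [H0, Matrix.one_apply, Fin.ext_iff, eq_comm]

lemma key {𝕂 : Type} [RCLike 𝕂] {m p : ℕ}
    (M₁ P₁ u : Matrix (Fin m) (Fin m) 𝕂) (H₁ K₁ c : Matrix (Fin p) (Fin m) 𝕂)
    (b x₁ : Matrix (Fin m) (Fin p) 𝕂) (d x₂ : Matrix (Fin p) (Fin p) 𝕂) :
    (H0 𝕂 (m + p) p = H0 𝕂 (m + p) p *
        Matrix.reindex finSumFinEquiv finSumFinEquiv (Matrix.fromBlocks u b c d) ∧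
      Matrix.reindex finSumFinEquiv finSumFinEquiv (Matrix.fromBlocks u b c d) *
        Matrix.reindex finSumFinEquiv finSumFinEquiv (Matrix.fromBlocks M₁ 0 H₁ 0) +
        Matrix.reindex finSumFinEquiv (Equiv.refl _) (Matrix.fromRows x₁ x₂) * H0 𝕂 (m + p) p =
      Matrix.reindex finSumFinEquiv finSumFinEquiv (Matrix.fromBlocks P₁ 0 K₁ 0) *
        Matrix.reindex finSumFinEquiv finSumFinEquiv (Matrix.fromBlocks u b c d)) ↔
    (c = 0 ∧ d = 1) ∧ u * M₁ + b * H₁ = P₁ * u ∧ x₁ = P₁ * b ∧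
      c * M₁ + d * H₁ = K₁ * u ∧ x₂ = K₁ * b := by
  rw [H0_eq]
  have e1 : Matrix.reindex (Equiv.refl (Fin p)) finSumFinEquiv
      (Matrix.fromCols (0 : Matrix (Fin p) (Fin m) 𝕂) (1 : Matrix (Fin p) (Fin p) 𝕂)) *
      Matrix.reindex finSumFinEquiv finSumFinEquiv (Matrix.fromBlocks u b c d) =
      Matrix.reindex (Equiv.refl (Fin p)) finSumFinEquiv (Matrix.fromCols c d) := by
    simp only [Matrix.reindex_apply, Matrix.submatrix_mul_equiv]
    rw [Matrix.fromCols_mul_fromBlocks]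
    simp
  have e2 : Matrix.reindex finSumFinEquiv (Equiv.refl (Fin p)) (Matrix.fromRows x₁ x₂) *
      Matrix.reindex (Equiv.refl (Fin p)) finSumFinEquiv
      (Matrix.fromCols (0 : Matrix (Fin p) (Fin m) 𝕂) (1 : Matrix (Fin p) (Fin p) 𝕂)) =
      Matrix.reindex finSumFinEquiv finSumFinEquiv (Matrix.fromBlocks 0 x₁ 0 x₂) := by
    simp only [Matrix.reindex_apply, Matrix.submatrix_mul_equiv]
    rw [Matrix.fromRows_mul_fromCols]
    simp
  rw [e1, e2]
  have e3 : ∀ A B : Matrix (Fin m ⊕ Fin p) (Fin m ⊕ Fin p) 𝕂,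
      Matrix.reindex finSumFinEquiv finSumFinEquiv A *
      Matrix.reindex finSumFinEquiv finSumFinEquiv B =
      Matrix.reindex finSumFinEquiv finSumFinEquiv (A * B) := by
    intro A B
    simp only [Matrix.reindex_apply, Matrix.submatrix_mul_equiv]
  have e4 : ∀ A B : Matrix (Fin m ⊕ Fin p) (Fin m ⊕ Fin p) 𝕂,
      Matrix.reindex finSumFinEquiv finSumFinEquiv A +
      Matrix.reindex finSumFinEquiv finSumFinEquiv B =
      Matrix.reindex finSumFinEquiv finSumFinEquiv (A + B) := by
    intro A B
    rfl
  rw [e3, e3, e4, (Matrix.reindex _ _).injective.eq_iff, (Matrix.reindex _ _).injective.eq_iff,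
    Matrix.fromBlocks_multiply, Matrix.fromBlocks_multiply, Matrix.fromBlocks_add,
    Matrix.fromBlocks_inj, Matrix.fromCols_inj.eq_iff]
  simp [eq_comm]

/-- For `n = m + p > p` (with `m = (k−1)p`, `k ≥ 2`) and
`M' = [[M₁,0],[H₁,0]]`, `P' = [[P₁,0],[K₁,0]]` (last `p` columns zero), the pairs
`(H₀,M')` and `(H₀,P')` lie in the same coadjoint `G_{n,p}(𝕂)`-orbit iff `(H₁,M₁)` and
`(K₁,P₁)` lie in the same coadjoint `G_{n−p,p}(𝕂)`-orbit. -/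
theorem stmt15 (𝕂 : Type) [RCLike 𝕂] (p k m : ℕ) (hp : 1 ≤ p) (hk : 2 ≤ k)
    (hm : m = (k - 1) * p)
    (M₁ P₁ : Matrix (Fin m) (Fin m) 𝕂) (H₁ K₁ : Matrix (Fin p) (Fin m) 𝕂) :
    (∃ (X : Matrix (Fin (m + p)) (Fin p) 𝕂) (U : GL (Fin (m + p)) 𝕂),
      ((H0 𝕂 (m + p) p * (U⁻¹).val,
        U.val * (Matrix.reindex finSumFinEquiv finSumFinEquiv
            (Matrix.fromBlocks M₁ 0 H₁ 0)) * (U⁻¹).val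
          + X * H0 𝕂 (m + p) p * (U⁻¹).val) :
          Matrix (Fin p) (Fin (m + p)) 𝕂 × Matrix (Fin (m + p)) (Fin (m + p)) 𝕂)
        = (H0 𝕂 (m + p) p,
           Matrix.reindex finSumFinEquiv finSumFinEquiv (Matrix.fromBlocks P₁ 0 K₁ 0)))
    ↔ (∃ (x : Matrix (Fin m) (Fin p) 𝕂) (u : GL (Fin m) 𝕂),
        ((H₁ * (u⁻¹).val, u.val * M₁ * (u⁻¹).val + x * H₁ * (u⁻¹).val) :
            Matrix (Fin p) (Fin m) 𝕂 × Matrix (Fin m) (Fin m) 𝕂)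
          = (K₁, P₁)) := by
  constructor
  · rintro ⟨X, U, h⟩
    rw [aux_iff] at h
    obtain ⟨V, hV⟩ := (Matrix.reindex finSumFinEquiv finSumFinEquiv).surjective U.val
    obtain ⟨Y, hY⟩ := (Matrix.reindex finSumFinEquiv (Equiv.refl (Fin p))).surjective X
    rw [← hY, ← hV, ← Matrix.fromBlocks_toBlocks V, ← Matrix.fromRows_toRows Y, key] at h
    obtain ⟨⟨hc, hd⟩, h1, -, h2, -⟩ := h
    have hdet : IsUnit (V.toBlocks₁₁) := by
      rw [Matrix.isUnit_iff_isUnit_det]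
      have hU : IsUnit U.val.det := (Matrix.isUnit_iff_isUnit_det _).1 U.isUnit
      rw [← hV, Matrix.det_reindex_self, ← Matrix.fromBlocks_toBlocks V, hc, hd,
        Matrix.det_fromBlocks_zero₂₁, Matrix.det_one, mul_one] at hU
      exact hU
    obtain ⟨u, hu⟩ := hdet
    refine ⟨V.toBlocks₁₂, u, ?_⟩
    rw [aux_iff, hu]
    refine ⟨?_, h1⟩
    rw [← h2, hc, hd]
    simp
  · rintro ⟨x, u, h⟩
    rw [aux_iff] at h
    obtain ⟨h1, h2⟩ := h
    have hdet : IsUnit (Matrix.reindex finSumFinEquiv finSumFinEquiv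
        (Matrix.fromBlocks u.val x 0 (1 : Matrix (Fin p) (Fin p) 𝕂))) := by
      rw [Matrix.isUnit_iff_isUnit_det, Matrix.det_reindex_self,
        Matrix.det_fromBlocks_zero₂₁, Matrix.det_one, mul_one]
      exact (Matrix.isUnit_iff_isUnit_det _).1 u.isUnit
    obtain ⟨U, hU⟩ := hdet
    refine ⟨Matrix.reindex finSumFinEquiv (Equiv.refl (Fin p))
      (Matrix.fromRows (P₁ * x) (K₁ * x)), U, ?_⟩
    rw [aux_iff, hU, key]
    exact ⟨⟨rfl, rfl⟩, h2, rfl, by simpa using h1, rfl⟩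
end

section
/- The stabilizer of (H₀,N₀) under the coadjoint action of G_{n,p}(𝕂) is trivial: if X ∈ M_{n,p}(𝕂) and U ∈ GL(n,𝕂) satisfy H₀·U⁻¹ = H₀ and U·N₀·U⁻¹ + X·H₀·U⁻¹ = N₀, then X = 0 and U = I_n. Consequently the orbit map (X,U) ↦ (X,U)·(H₀,N₀) is injective, and the identity component of G_{n,p}(𝕂) is in bijection with an open coadjoint orbit. -/
open Matrix

section aux

variable {𝕂 : Type} [RCLike 𝕂]

theorem H0_mul_apply {n p m : ℕ} (hpn : p ≤ n) (Z : Matrix (Fin n) (Fin m) 𝕂) (i : Fin p)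
    (j : Fin m) :
    (H0 𝕂 n p * Z) i j = Z ⟨n - p + i, by omega⟩ j := by
  rw [Matrix.mul_apply, Finset.sum_eq_single ⟨n - p + i, by omega⟩]
  · simp [H0]
  · intro b _ hb
    have : (b : ℕ) ≠ n - p + i := fun h => hb (Fin.ext h)
    simp [H0, this]
  · simp

theorem mul_H0_apply_lt {n p m : ℕ} (Y : Matrix (Fin m) (Fin p) 𝕂) (i : Fin m)
    (j : Fin n) (hj : (j : ℕ) + p < n) :
    (Y * H0 𝕂 n p) i j = 0 := by
  rw [Matrix.mul_apply]
  refine Finset.sum_eq_zero fun b _ => ?_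
  have : (j : ℕ) ≠ n - p + b := by omega
  simp [H0, this]

theorem mul_H0_apply_last {n p m : ℕ} (hpn : p ≤ n) (Y : Matrix (Fin m) (Fin p) 𝕂) (i : Fin m)
    (l : Fin p) :
    (Y * H0 𝕂 n p) i ⟨n - p + l, by omega⟩ = Y i l := by
  rw [Matrix.mul_apply, Finset.sum_eq_single l]
  · simp [H0]
  · intro b _ hb
    have : (l : ℕ) ≠ b := fun h => hb (Fin.ext h.symm)
    simp [H0, this]
  · simp

theorem mul_N0_apply {n p : ℕ} (Z : Matrix (Fin n) (Fin n) 𝕂) (i j : Fin n)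
    (hj : (j : ℕ) + p < n) :
    (Z * N0 𝕂 n p) i j = Z i ⟨j + p, hj⟩ := by
  rw [Matrix.mul_apply, Finset.sum_eq_single ⟨j + p, hj⟩]
  · simp [N0]
  · intro b _ hb
    have : (b : ℕ) ≠ j + p := fun h => hb (Fin.ext h)
    simp [N0, this]
  · simp

theorem N0_mul_apply_lt {n p : ℕ} (Z : Matrix (Fin n) (Fin n) 𝕂) (i j : Fin n)
    (hi : (i : ℕ) < p) :
    (N0 𝕂 n p * Z) i j = 0 := by
  rw [Matrix.mul_apply]
  refine Finset.sum_eq_zero fun b _ => ?_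
  have : (i : ℕ) ≠ b + p := by omega
  simp [N0, this]

theorem N0_mul_apply {n p : ℕ} (Z : Matrix (Fin n) (Fin n) 𝕂) (i j : Fin n)
    (hi : (i : ℕ) + p < n) :
    (N0 𝕂 n p * Z) ⟨i + p, hi⟩ j = Z i j := by
  rw [Matrix.mul_apply, Finset.sum_eq_single i]
  · simp [N0]
  · intro b _ hb
    have : (i : ℕ) ≠ b := fun h => hb (Fin.ext h.symm)
    simp [N0, this]
  · simp

theorem lin_lemma {p k n : ℕ} (hp : 1 ≤ p) (hk : 1 ≤ k) (hn : n = k * p)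
    (Z : Matrix (Fin n) (Fin n) 𝕂) (Y : Matrix (Fin n) (Fin p) 𝕂)
    (h1 : H0 𝕂 n p * Z = 0) (h2 : Z * N0 𝕂 n p = N0 𝕂 n p * Z + Y * H0 𝕂 n p) :
    Z = 0 ∧ Y = 0 := by
  have hpn : p ≤ n := by rw [hn]; exact Nat.le_mul_of_pos_left p hk
  have hlast : ∀ i j : Fin n, n ≤ (i : ℕ) + p → Z i j = 0 := by
    intro i j hi
    have := H0_mul_apply hpn Z ⟨i - (n - p), by omega⟩ j
    rw [h1] at this
    simp only [Matrix.zero_apply] at this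
    rw [this]; congr 1; ext; simp; omega
  have hfirst : ∀ i j : Fin n, (i : ℕ) < p → ∀ hj : (j : ℕ) + p < n, Z i ⟨j + p, hj⟩ = 0 := by
    intro i j hi hj
    rw [← mul_N0_apply Z i j hj, h2, Matrix.add_apply, N0_mul_apply_lt _ _ _ hi,
      mul_H0_apply_lt _ _ _ hj, add_zero]
  have hdiag : ∀ i j : Fin n, ∀ hi : (i : ℕ) + p < n, ∀ hj : (j : ℕ) + p < n,
      Z ⟨i + p, hi⟩ ⟨j + p, hj⟩ = Z i j := by
    intro i j hi hj
    rw [← mul_N0_apply Z _ j hj, h2, Matrix.add_apply, N0_mul_apply _ _ _ hi,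
      mul_H0_apply_lt _ _ _ hj, add_zero]
  have hup : ∀ m : ℕ, ∀ i j : Fin n, n - i ≤ m → (j : ℕ) / p ≤ (i : ℕ) / p → Z i j = 0 := by
    intro m
    induction m with
    | zero => intro i j h; omega
    | succ m ih =>
      intro i j hm hji
      by_cases hi : (i : ℕ) + p < n
      · have hj : (j : ℕ) + p < n := by
          have hi' : ((i : ℕ) + p) / p < k := (Nat.div_lt_iff_lt_mul hp).2 (hi.trans_eq hn)
          have hj' : ((j : ℕ) + p) / p < k := by
            rw [Nat.add_div_right _ hp] at hi' ⊢
            omega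
          exact ((Nat.div_lt_iff_lt_mul hp).1 hj').trans_eq hn.symm
        rw [← hdiag i j hi hj]
        refine ih _ _ ?_ ?_
        · simp only; omega
        · simp only [Nat.add_div_right _ hp]; omega
      · exact hlast i j (by omega)
  have hdown : ∀ m : ℕ, ∀ i j : Fin n, (i : ℕ) ≤ m → (i : ℕ) / p < (j : ℕ) / p → Z i j = 0 := by
    intro m
    induction m using Nat.strong_induction_on with
    | _ m ih =>
      intro i j hm hij
      have hj : p ≤ (j : ℕ) := by
        by_contra hc
        rw [Nat.div_eq_of_lt (not_le.mp hc)] at hij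
        exact absurd hij (Nat.not_lt_zero _)
      obtain ⟨j', hj', ej⟩ : ∃ j' : Fin n, ∃ h : (j' : ℕ) + p < n, j = ⟨j' + p, h⟩ :=
        ⟨⟨j - p, by omega⟩, by simp only; omega, by ext; simp only; omega⟩
      by_cases hi : (i : ℕ) < p
      · rw [ej]; exact hfirst i _ hi _
      · obtain ⟨i', hi', ei⟩ : ∃ i' : Fin n, ∃ h : (i' : ℕ) + p < n, i = ⟨i' + p, h⟩ :=
          ⟨⟨i - p, by omega⟩, by simp only; omega, by ext; simp only; omega⟩
        subst ei ej
        rw [hdiag]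
        simp only [Nat.add_div_right _ hp] at hij hm
        exact ih i' (by omega) _ _ (le_refl _) (by omega)
  have hZ : Z = 0 := by
    ext i j
    rcases le_or_gt ((j : ℕ) / p) ((i : ℕ) / p) with h | h
    · exact hup _ i j le_rfl h
    · exact hdown _ i j le_rfl h
  refine ⟨hZ, ?_⟩
  subst hZ
  ext i l
  rw [← mul_H0_apply_last hpn Y i l]
  have := congrFun (congrFun h2 i) ⟨n - p + l, by omega⟩
  simpa using this.symm

/-- uniqueness at a point of the orbit -/
theorem lin_lemma2 {p k n : ℕ} (hp : 1 ≤ p) (hk : 1 ≤ k) (hn : n = k * p)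
    (X : Matrix (Fin n) (Fin p) 𝕂) (U : GL (Fin n) 𝕂)
    (Z : Matrix (Fin n) (Fin n) 𝕂) (Y : Matrix (Fin n) (Fin p) 𝕂)
    (h1 : H0 𝕂 n p * Z = 0)
    (h2 : Z * (U.val * N0 𝕂 n p * (U⁻¹).val + X * H0 𝕂 n p * (U⁻¹).val) =
      N0 𝕂 n p * Z + Y * (H0 𝕂 n p * (U⁻¹).val)) :
    Z = 0 ∧ Y = 0 := by
  have hU : (U⁻¹).val * U.val = 1 := U.inv_mul
  have hU' : U.val * (U⁻¹).val = 1 := U.mul_inv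
  have key := lin_lemma (𝕂 := 𝕂) hp hk hn (Z * U.val) (Y - Z * X)
    (by rw [← Matrix.mul_assoc, h1, Matrix.zero_mul]) (by
      have := congrArg (· * U.val) h2
      simp only [Matrix.mul_add, Matrix.add_mul, Matrix.mul_assoc, hU, Matrix.mul_one] at this
      simp only [Matrix.sub_mul, Matrix.mul_assoc]
      rw [← add_sub_assoc, ← this]; abel)
  have hZ : Z = 0 := by
    have := congrArg (· * (U⁻¹).val) key.1
    simpa [Matrix.mul_assoc, hU'] using this
  refine ⟨hZ, ?_⟩
  simpa [hZ] using key.2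

def Lmap (n p : ℕ) (b : Matrix (Fin p) (Fin n) 𝕂 × Matrix (Fin n) (Fin n) 𝕂) :
    (Matrix (Fin n) (Fin p) 𝕂 × Matrix (Fin n) (Fin n) 𝕂) →ₗ[𝕂]
      (Matrix (Fin p) (Fin n) 𝕂 × Matrix (Fin n) (Fin n) 𝕂) where
  toFun z := (H0 𝕂 n p * z.2, z.2 * b.2 - N0 𝕂 n p * z.2 - z.1 * b.1)
  map_add' x y := by
    ext1
    · simp [Matrix.mul_add]
    · simp only [Prod.snd_add, Prod.fst_add, Matrix.mul_add, Matrix.add_mul]; abel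
  map_smul' c x := by
    ext1
    · simp
    · simp [smul_sub]

section top

attribute [local instance] Matrix.linftyOpNormedRing Matrix.linftyOpNormedAlgebra

theorem GL_isOpenEmbedding (n : ℕ) :
    Topology.IsOpenEmbedding (Units.val : GL (Fin n) 𝕂 → Matrix (Fin n) (Fin n) 𝕂) :=
  have : CompleteSpace (Matrix (Fin n) (Fin n) 𝕂) := FiniteDimensional.complete 𝕂 _
  Units.isOpenEmbedding_val

end top

theorem psi_open (n p : ℕ) : IsOpenMap
    (fun g : Matrix (Fin n) (Fin p) 𝕂 × GL (Fin n) 𝕂 =>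
      (((g.2⁻¹).val * g.1, (g.2⁻¹).val) :
        Matrix (Fin n) (Fin p) 𝕂 × Matrix (Fin n) (Fin n) 𝕂)) := by
  let e : Matrix (Fin n) (Fin p) 𝕂 × GL (Fin n) 𝕂 ≃ₜ Matrix (Fin n) (Fin p) 𝕂 × GL (Fin n) 𝕂 :=
    { toFun := fun g => ((g.2⁻¹).val * g.1, g.2⁻¹)
      invFun := fun g => ((g.2⁻¹).val * g.1, g.2⁻¹)
      left_inv := fun g => by
        ext1
        · change (g.2⁻¹⁻¹).val * ((g.2⁻¹).val * g.1) = g.1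
          rw [← Matrix.mul_assoc, Units.inv_mul, Matrix.one_mul]
        · simp
      right_inv := fun g => by
        ext1
        · change (g.2⁻¹⁻¹).val * ((g.2⁻¹).val * g.1) = g.1
          rw [← Matrix.mul_assoc, Units.inv_mul, Matrix.one_mul]
        · simp
      continuous_toFun := ((Units.continuous_val.comp continuous_snd.inv).matrix_mul
        continuous_fst).prodMk continuous_snd.inv
      continuous_invFun := ((Units.continuous_val.comp continuous_snd.inv).matrix_mul
        continuous_fst).prodMk continuous_snd.inv }
  exact (IsOpenMap.id.prodMap (GL_isOpenEmbedding (𝕂 := 𝕂) n).isOpenMap).comp e.isOpenMap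

theorem comp_open (n p : ℕ) : IsOpen
    (connectedComponent ((0, 1) : Matrix (Fin n) (Fin p) 𝕂 × GL (Fin n) 𝕂)) := by
  have : LocallyConnectedSpace 𝕂 := by
    let _ : NormedSpace ℝ 𝕂 := inferInstance
    infer_instance
  have : LocallyConnectedSpace (Matrix (Fin n) (Fin p) 𝕂) :=
    inferInstanceAs (LocallyConnectedSpace (Fin n → Fin p → 𝕂))
  have : LocallyConnectedSpace (Matrix (Fin n) (Fin n) 𝕂) :=
    inferInstanceAs (LocallyConnectedSpace (Fin n → Fin n → 𝕂))
  have : LocallyConnectedSpace (GL (Fin n) 𝕂) :=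
    (GL_isOpenEmbedding (𝕂 := 𝕂) n).locallyConnectedSpace
  exact isOpen_connectedComponent

/-- Solutions of a continuously varying linear system vary continuously. -/
theorem solve_cont {B E F : Type*} [TopologicalSpace B]
    [NormedAddCommGroup E] [NormedSpace 𝕂 E] [FiniteDimensional 𝕂 E]
    [NormedAddCommGroup F] [NormedSpace 𝕂 F] [FiniteDimensional 𝕂 F]
    (hdim : Module.finrank 𝕂 E = Module.finrank 𝕂 F)
    (L : B → E →ₗ[𝕂] F) (hL : ∀ z, Continuous fun b => L b z) (r : B → F) (hr : Continuous r)
    (b₀ : B) (hinj : Function.Injective (L b₀)) (z₀ : E) (hz : L b₀ z₀ = r b₀)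
    (O : Set E) (hO : O ∈ nhds z₀) :
    ∀ᶠ b in nhds b₀, ∃ z ∈ O, L b z = r b := by
  have : CompleteSpace E := FiniteDimensional.complete 𝕂 E
  let L' : B → E →L[𝕂] F := fun b => LinearMap.toContinuousLinearMap (L b)
  have hL' : Continuous L' := continuous_clm_apply.2 fun z => hL z
  let e : E ≃L[𝕂] F := (LinearMap.linearEquivOfInjective (L b₀) hinj hdim).toContinuousLinearEquiv
  have he : (e : E →L[𝕂] F) = L' b₀ := by
    ext z; rfl
  have hc : ContinuousAt (fun b => ContinuousLinearMap.inverse (L' b) (r b)) b₀ := by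
    have h1 : ContinuousAt ContinuousLinearMap.inverse (L' b₀) := by
      rw [← he]
      exact (contDiffAt_map_inverse (n := 0) e).continuousAt
    have h2 : ContinuousAt (fun b => ContinuousLinearMap.inverse (L' b)) b₀ :=
      ContinuousAt.comp (f := L') h1 hL'.continuousAt
    exact h2.clm_apply hr.continuousAt
  have hz0 : ContinuousLinearMap.inverse (L' b₀) (r b₀) = z₀ := by
    rw [← he, ContinuousLinearMap.inverse_equiv, ← hz]
    exact e.symm_apply_apply z₀
  have hev : ∀ᶠ b in nhds b₀, L' b ∈ Set.range ((↑) : (E ≃L[𝕂] F) → E →L[𝕂] F) := by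
    refine hL'.continuousAt ?_
    rw [← he]
    exact ContinuousLinearEquiv.nhds e
  have hO' : ∀ᶠ b in nhds b₀, ContinuousLinearMap.inverse (L' b) (r b) ∈ O :=
    hc (by beta_reduce; rw [hz0]; exact hO)
  filter_upwards [hev, hO'] with b hb hbO
  obtain ⟨e', he'⟩ := hb
  refine ⟨_, hbO, ?_⟩
  change L' b _ = _
  rw [← he', ContinuousLinearMap.inverse_equiv]
  exact e'.apply_symm_apply _

section top2

attribute [local instance] Matrix.normedAddCommGroup Matrix.normedSpace

theorem solve_mat {n p : ℕ} (b₀ : Matrix (Fin p) (Fin n) 𝕂 × Matrix (Fin n) (Fin n) 𝕂)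
    (hinj : Function.Injective (Lmap n p b₀))
    (z₀ : Matrix (Fin n) (Fin p) 𝕂 × Matrix (Fin n) (Fin n) 𝕂)
    (hz : Lmap n p b₀ z₀ = (b₀.1, 0))
    (O : Set (Matrix (Fin n) (Fin p) 𝕂 × Matrix (Fin n) (Fin n) 𝕂)) (hO : O ∈ nhds z₀) :
    ∀ᶠ b in nhds b₀, ∃ z ∈ O, Lmap n p b z = (b.1, 0) := by
  refine solve_cont ?_ (fun b => Lmap n p b) ?_ (fun b => (b.1, 0)) ?_ b₀ hinj z₀ hz O hO
  · simp [Module.finrank_prod, Module.finrank_matrix, mul_comm]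
  · intro z
    refine Continuous.prodMk continuous_const ?_
    exact ((continuous_const.matrix_mul continuous_snd).sub continuous_const).sub
      (continuous_const.matrix_mul continuous_fst)
  · exact continuous_fst.prodMk continuous_const

end top2

end aux

/-- The coadjoint stabilizer of `(H₀,N₀)` in `G_{n,p}(𝕂)` is trivial; hence
the orbit map `(X,U) ↦ (X,U)·(H₀,N₀)` is injective, and it puts the identity component of
`G_{n,p}(𝕂)` (the connected component of `(0,1)` in `M_{n,p}(𝕂) × GL(n,𝕂)`) in bijection
with its image, an open coadjoint orbit. -/
theorem stmt16 (𝕂 : Type) [RCLike 𝕂] (p k n : ℕ) (hp : 1 ≤ p) (hk : 1 ≤ k)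
    (hn : n = k * p) :
    let f : Matrix (Fin n) (Fin p) 𝕂 × GL (Fin n) 𝕂 →
        Matrix (Fin p) (Fin n) 𝕂 × Matrix (Fin n) (Fin n) 𝕂 := fun g =>
      (H0 𝕂 n p * (g.2⁻¹).val,
       g.2.val * N0 𝕂 n p * (g.2⁻¹).val + g.1 * H0 𝕂 n p * (g.2⁻¹).val)
    -- trivial stabilizer
    (∀ (X : Matrix (Fin n) (Fin p) 𝕂) (U : GL (Fin n) 𝕂),
      H0 𝕂 n p * (U⁻¹).val = H0 𝕂 n p →
      U.val * N0 𝕂 n p * (U⁻¹).val + X * H0 𝕂 n p * (U⁻¹).val = N0 𝕂 n p →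
      X = 0 ∧ U = 1) ∧
    -- injectivity of the orbit map
    Function.Injective f ∧
    -- the identity component is in bijection with an open orbit
    IsOpen (f '' connectedComponent ((0, 1) : Matrix (Fin n) (Fin p) 𝕂 × GL (Fin n) 𝕂)) ∧
    Set.BijOn f (connectedComponent ((0, 1) : Matrix (Fin n) (Fin p) 𝕂 × GL (Fin n) 𝕂))
      (f '' connectedComponent ((0, 1) : Matrix (Fin n) (Fin p) 𝕂 × GL (Fin n) 𝕂)) := by
  intro f
  have hfac : ∀ g : Matrix (Fin n) (Fin p) 𝕂 × GL (Fin n) 𝕂,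
      Lmap n p (f g) ((g.2⁻¹).val * g.1, (g.2⁻¹).val) = ((f g).1, 0) := by
    intro g
    have hU : (g.2⁻¹).val * g.2.val = 1 := g.2.inv_mul
    refine Prod.ext rfl ?_
    change (g.2⁻¹).val * (g.2.val * N0 𝕂 n p * (g.2⁻¹).val + g.1 * H0 𝕂 n p * (g.2⁻¹).val)
      - N0 𝕂 n p * (g.2⁻¹).val - (g.2⁻¹).val * g.1 * (H0 𝕂 n p * (g.2⁻¹).val) = 0
    have h3 : (g.2⁻¹).val * (g.2.val * N0 𝕂 n p * (g.2⁻¹).val) = N0 𝕂 n p * (g.2⁻¹).val := by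
      rw [← Matrix.mul_assoc, ← Matrix.mul_assoc, hU, Matrix.one_mul]
    rw [Matrix.mul_add, h3]
    simp only [Matrix.mul_assoc]
    abel
  have hLinj : ∀ g, Function.Injective (Lmap n p (f g)) := by
    intro g
    rw [injective_iff_map_eq_zero]
    rintro ⟨Y, Z⟩ h
    have h1 : H0 𝕂 n p * Z = 0 := congrArg Prod.fst h
    have h2 : Z * (f g).2 - N0 𝕂 n p * Z - Y * (f g).1 = 0 := congrArg Prod.snd h
    rw [sub_sub, sub_eq_zero] at h2
    obtain ⟨a, b⟩ := lin_lemma2 hp hk hn g.1 g.2 Z Y h1 h2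
    rw [a, b]; rfl
  have hinj : Function.Injective f := by
    intro g g' h
    have h1 := hfac g
    have h2 := hfac g'
    rw [← h] at h2
    have h3 := hLinj g (h1.trans h2.symm)
    have hv : (g.2⁻¹).val = (g'.2⁻¹).val := congrArg Prod.snd h3
    have hU : g.2 = g'.2 := inv_injective (Units.ext hv)
    have hy : (g.2⁻¹).val * g.1 = (g'.2⁻¹).val * g'.1 := congrArg Prod.fst h3
    refine Prod.ext ?_ hU
    rw [← hU] at hy
    have h4 := congrArg (g.2.val * ·) hy
    have h5 : g.2.val * (g.2⁻¹).val = 1 := g.2.mul_inv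
    simpa only [← Matrix.mul_assoc, h5, Matrix.one_mul] using h4
  refine ⟨?_, hinj, ?_, hinj.injOn.bijOn_image⟩
  · intro X U h1 h2
    have : f (X, U) = f (0, 1) := by
      refine Prod.ext ?_ ?_
      · simpa [f] using h1
      · simpa [f] using h2
    have h := hinj this
    exact ⟨congrArg Prod.fst h, congrArg Prod.snd h⟩
  · rw [isOpen_iff_mem_nhds]
    rintro _ ⟨g, hg, rfl⟩
    have hO := (psi_open (𝕂 := 𝕂) n p).image_mem_nhds ((comp_open (𝕂 := 𝕂) n p).mem_nhds hg)
    filter_upwards [solve_mat (f g) (hLinj g) _ (hfac g) _ hO] with b hb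
    obtain ⟨_, ⟨g', hg', rfl⟩, hb⟩ := hb
    refine ⟨g', hg', ?_⟩
    have h1 : H0 𝕂 n p * (g'.2⁻¹).val = b.1 := congrArg Prod.fst hb
    have h2 : (g'.2⁻¹).val * b.2 - N0 𝕂 n p * (g'.2⁻¹).val - (g'.2⁻¹).val * g'.1 * b.1 = 0 :=
      congrArg Prod.snd hb
    refine Prod.ext h1 ?_
    change g'.2.val * N0 𝕂 n p * (g'.2⁻¹).val + g'.1 * H0 𝕂 n p * (g'.2⁻¹).val = b.2
    rw [sub_sub, sub_eq_zero] at h2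
    have h4 := congrArg (g'.2.val * ·) h2
    have h5 : g'.2.val * (g'.2⁻¹).val = 1 := g'.2.mul_inv
    simp only [Matrix.mul_add, ← Matrix.mul_assoc, h5, Matrix.one_mul] at h4
    rw [h4, ← h1, Matrix.mul_assoc g'.1]
end

section
/- The symplectic Lie algebra (𝒢_{n,p}(𝕂), δα_{(H₀,N₀)}) admits two transverse Lagrangian subalgebras: let L = {(x,u) ∈ 𝒢_{n,p}(𝕂) : u is strictly upper triangular by p×p blocks} and L' = {(0,u) ∈ 𝒢_{n,p}(𝕂) : u is lower triangular by p×p blocks (diagonal blocks allowed)}. Then L and L' are Lie subalgebras of 𝒢_{n,p}(𝕂), 𝒢_{n,p}(𝕂) = L ⊕ L' as vector spaces, each of L and L' is totally isotropic for ω = δα_{(H₀,N₀)} (ω(a,b) = 0 for all a, b in L, and likewise for L'), and each has dimension p²k(k+1)/2, half the dimension of 𝒢_{n,p}(𝕂); hence L and L' are Lagrangian. -/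
open Matrix

/-- `L = {(x,u) : u` strictly upper triangular by `p×p` blocks`}`. -/
def Ltri (𝕂 : Type) [RCLike 𝕂] (n p : ℕ) : Submodule 𝕂 (GA 𝕂 n p) where
  carrier := {a | ∀ i j : Fin n, (j : ℕ) / p ≤ (i : ℕ) / p → a.2 i j = 0}
  add_mem' := fun {a b} ha hb i j hij => by
    simp only [Prod.snd_add, Matrix.add_apply, ha i j hij, hb i j hij, add_zero]
  zero_mem' := fun i j _ => rfl
  smul_mem' := fun c a ha i j hij => by
    simp only [Prod.smul_snd, Matrix.smul_apply, ha i j hij, smul_zero]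

/-- `L' = {(0,u) : u` lower triangular by `p×p` blocks`}`. -/
def Ltri' (𝕂 : Type) [RCLike 𝕂] (n p : ℕ) : Submodule 𝕂 (GA 𝕂 n p) where
  carrier := {a | a.1 = 0 ∧ ∀ i j : Fin n, (i : ℕ) / p < (j : ℕ) / p → a.2 i j = 0}
  add_mem' := fun {a b} ha hb => by
    refine ⟨?_, fun i j hij => ?_⟩
    · simp [Prod.fst_add, ha.1, hb.1]
    · simp only [Prod.snd_add, Matrix.add_apply, ha.2 i j hij, hb.2 i j hij, add_zero]
  zero_mem' := ⟨rfl, fun i j _ => rfl⟩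
  smul_mem' := fun c a ha => by
    refine ⟨?_, fun i j hij => ?_⟩
    · simp [Prod.smul_fst, ha.1]
    · simp only [Prod.smul_snd, Matrix.smul_apply, ha.2 i j hij, smul_zero]

lemma aux_lt {p k n : ℕ} (hn : n = k * p) (i : Fin n) (c : Fin p) :
    p * ((i : ℕ) / p) + (c : ℕ) < n := by
  have hp : 0 < p := by have := c.2; omega
  have h1 : (i : ℕ) / p < k := by
    rw [Nat.div_lt_iff_lt_mul hp, ← hn]; exact i.2
  have h2 : p * ((i : ℕ) / p + 1) ≤ p * k := Nat.mul_le_mul_left _ h1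
  have := c.2
  have h3 : n = p * k := by rw [hn, Nat.mul_comm]
  rw [Nat.mul_add] at h2
  omega

lemma aux_div {p : ℕ} (i : ℕ) (c : Fin p) : (p * (i / p) + (c : ℕ)) / p = i / p := by
  have hp : 0 < p := by have := c.2; omega
  rw [Nat.mul_add_div hp, Nat.div_eq_of_lt c.2, add_zero]

lemma aux_mod {p : ℕ} (i : ℕ) (c : Fin p) : (p * (i / p) + (c : ℕ)) % p = c := by
  rw [Nat.mul_add_mod, Nat.mod_eq_of_lt c.2]

/-- map L to L' -/
def phi (𝕂 : Type) [RCLike 𝕂] (n p : ℕ) (hp : 0 < p) : GA 𝕂 n p →ₗ[𝕂] GA 𝕂 n p where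
  toFun a := (0, Matrix.of fun i j => if (j : ℕ) / p < (i : ℕ) / p then a.2 j i else
    if (j : ℕ) / p = (i : ℕ) / p then a.1 i ⟨(j : ℕ) % p, Nat.mod_lt _ hp⟩ else 0)
  map_add' a b := by
    ext i j
    · simp
    · simp only [Prod.snd_add, Prod.fst_add, Matrix.add_apply, Matrix.of_apply]
      split_ifs <;> simp
  map_smul' c a := by
    ext i j
    · simp
    · simp only [Prod.smul_snd, Prod.smul_fst, Matrix.smul_apply, Matrix.of_apply,
        RingHom.id_apply]
      split_ifs <;> simp

/-- map L' to L -/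
def psi (𝕂 : Type) [RCLike 𝕂] (n p k : ℕ) (hn : n = k * p) : GA 𝕂 n p →ₗ[𝕂] GA 𝕂 n p where
  toFun a := (Matrix.of fun i c => a.2 i ⟨_, aux_lt hn i c⟩,
    Matrix.of fun i j => if (i : ℕ) / p < (j : ℕ) / p then a.2 j i else 0)
  map_add' a b := by
    ext i j
    · simp
    · simp only [Prod.snd_add, Matrix.add_apply, Matrix.of_apply]
      split_ifs <;> simp
  map_smul' c a := by
    ext i j
    · simp
    · simp only [Prod.smul_snd, Matrix.smul_apply, Matrix.of_apply,
        RingHom.id_apply]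
      split_ifs <;> simp

lemma mem_L {𝕂 : Type} [RCLike 𝕂] {n p : ℕ} (a : GA 𝕂 n p) : a ∈ Ltri 𝕂 n p ↔
    ∀ i j : Fin n, (j : ℕ) / p ≤ (i : ℕ) / p → a.2 i j = 0 := Iff.rfl

lemma mem_L' {𝕂 : Type} [RCLike 𝕂] {n p : ℕ} (a : GA 𝕂 n p) : a ∈ Ltri' 𝕂 n p ↔
    a.1 = 0 ∧ ∀ i j : Fin n, (i : ℕ) / p < (j : ℕ) / p → a.2 i j = 0 := Iff.rfl

lemma le1 (𝕂 : Type) [RCLike 𝕂] (p k n : ℕ) (hp : 1 ≤ p) (hn : n = k * p) :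
    Module.finrank 𝕂 (Ltri 𝕂 n p) ≤ Module.finrank 𝕂 (Ltri' 𝕂 n p) := by
  have hm : ∀ a ∈ Ltri 𝕂 n p, phi 𝕂 n p hp a ∈ Ltri' 𝕂 n p := by
    intro a _
    refine ⟨rfl, fun i j hij => ?_⟩
    simp [phi, not_lt.2 hij.le, hij.ne']
  refine LinearMap.finrank_le_finrank_of_injective (f := (phi 𝕂 n p hp).restrict hm) ?_
  rw [← LinearMap.ker_eq_bot, LinearMap.ker_eq_bot']
  rintro ⟨a, ha⟩ h
  have h2 : (phi 𝕂 n p hp a).2 = 0 := congrArg (fun z => z.1.2) h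
  have h3 : ∀ i j, (phi 𝕂 n p hp a).2 i j = 0 := fun i j => by rw [h2]; rfl
  simp only [phi, LinearMap.coe_mk, AddHom.coe_mk, Matrix.of_apply] at h3
  apply Subtype.ext
  refine Prod.ext ?_ ?_
  · ext i c
    have := h3 i ⟨_, aux_lt hn i c⟩
    simpa [aux_div, aux_mod, Nat.mod_eq_of_lt c.2] using this
  · ext i j
    by_cases hij : (i : ℕ) / p < (j : ℕ) / p
    · have := h3 j i
      simpa [hij] using this
    · exact ha i j (not_lt.1 hij)

lemma le2 (𝕂 : Type) [RCLike 𝕂] (p k n : ℕ) (hp : 1 ≤ p) (hn : n = k * p) :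
    Module.finrank 𝕂 (Ltri' 𝕂 n p) ≤ Module.finrank 𝕂 (Ltri 𝕂 n p) := by
  have hm : ∀ a ∈ Ltri' 𝕂 n p, psi 𝕂 n p k hn a ∈ Ltri 𝕂 n p := by
    intro a _ i j hij
    simp [psi, not_lt.2 hij]
  refine LinearMap.finrank_le_finrank_of_injective (f := (psi 𝕂 n p k hn).restrict hm) ?_
  rw [← LinearMap.ker_eq_bot, LinearMap.ker_eq_bot']
  rintro ⟨a, ha⟩ h
  have h1 : (psi 𝕂 n p k hn a).1 = 0 := congrArg (fun z => z.1.1) h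
  have h2 : (psi 𝕂 n p k hn a).2 = 0 := congrArg (fun z => z.1.2) h
  have h3 : ∀ i j, (psi 𝕂 n p k hn a).2 i j = 0 := fun i j => by rw [h2]; rfl
  have h4 : ∀ i j, (psi 𝕂 n p k hn a).1 i j = 0 := fun i j => by rw [h1]; rfl
  simp only [psi, LinearMap.coe_mk, AddHom.coe_mk, Matrix.of_apply] at h3 h4
  apply Subtype.ext
  refine Prod.ext ha.1 ?_
  ext i j
  rcases lt_trichotomy ((i : ℕ) / p) ((j : ℕ) / p) with hij | hij | hij
  · exact ha.2 i j hij
  · have := h4 i ⟨(j : ℕ) % p, Nat.mod_lt _ hp⟩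
    have e : p * ((i : ℕ) / p) + (j : ℕ) % p = j := by rw [hij, Nat.div_add_mod]
    simpa [e] using this
  · have := h3 j i
    simpa [hij] using this

lemma N0_div {p a b : ℕ} (hp : 1 ≤ p) (h : a = b + p) : a / p = b / p + 1 := by
  rw [h, Nat.add_div_right _ hp]

lemma Ltri_mul_aux {𝕂 : Type} [RCLike 𝕂] {n p : ℕ} {a b : GA 𝕂 n p} (ha : a ∈ Ltri 𝕂 n p)
    (hb : b ∈ Ltri 𝕂 n p) (i j : Fin n) (h : (j : ℕ) / p ≤ (i : ℕ) / p + 1) :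
    (a.2 * b.2) i j = 0 := by
  rw [Matrix.mul_apply]
  refine Finset.sum_eq_zero fun l _ => ?_
  by_cases hl : (l : ℕ) / p ≤ (i : ℕ) / p
  · rw [ha i l hl, zero_mul]
  · rw [hb l j (by omega), mul_zero]

lemma Ltri_mul_aux' {𝕂 : Type} [RCLike 𝕂] {n p : ℕ} {a b : GA 𝕂 n p} (ha : a ∈ Ltri' 𝕂 n p)
    (hb : b ∈ Ltri' 𝕂 n p) (i j : Fin n) (h : (i : ℕ) / p < (j : ℕ) / p) :
    (a.2 * b.2) i j = 0 := by
  rw [Matrix.mul_apply]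
  refine Finset.sum_eq_zero fun l _ => ?_
  by_cases hl : (i : ℕ) / p < (l : ℕ) / p
  · rw [ha.2 i l hl, zero_mul]
  · rw [hb.2 l j (by omega), mul_zero]

lemma trN {𝕂 : Type} [RCLike 𝕂] {n p : ℕ} (hp : 1 ≤ p) (m : Matrix (Fin n) (Fin n) 𝕂)
    (hm : ∀ i j : Fin n, (j : ℕ) / p = (i : ℕ) / p + 1 → m i j = 0) :
    trace (N0 𝕂 n p * m) = 0 := by
  rw [Matrix.trace]
  refine Finset.sum_eq_zero fun i _ => ?_
  rw [Matrix.diag_apply, Matrix.mul_apply]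
  refine Finset.sum_eq_zero fun l _ => ?_
  simp only [N0, Matrix.of_apply]
  split_ifs with h
  · rw [hm l i (N0_div hp h), mul_zero]
  · rw [zero_mul]

lemma trH {𝕂 : Type} [RCLike 𝕂] {n p k : ℕ} (hp : 1 ≤ p) (hk : 1 ≤ k) (hn : n = k * p)
    {a : GA 𝕂 n p} (ha : a ∈ Ltri 𝕂 n p) (y : Matrix (Fin n) (Fin p) 𝕂) :
    trace (a.2 * y * H0 𝕂 n p) = 0 := by
  rw [Matrix.trace]
  refine Finset.sum_eq_zero fun i _ => ?_
  rw [Matrix.diag_apply, Matrix.mul_apply]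
  refine Finset.sum_eq_zero fun c _ => ?_
  simp only [H0, Matrix.of_apply]
  split_ifs with h
  · rw [mul_one, Matrix.mul_apply]
    refine Finset.sum_eq_zero fun l _ => ?_
    rw [ha i l, zero_mul]
    have h1 : (l : ℕ) / p < k := by
      rw [Nat.div_lt_iff_lt_mul hp, ← hn]; exact l.2
    have h2 : k - 1 ≤ (i : ℕ) / p := by
      rw [Nat.le_div_iff_mul_le hp, Nat.sub_mul, one_mul, ← hn]; omega
    omega
  · rw [mul_zero]

/-- the subspaces `L` and `L'` are Lie subalgebras of `𝒢_{n,p}(𝕂)`,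
`𝒢_{n,p}(𝕂) = L ⊕ L'`, each is totally isotropic for `ω = δα_{(H₀,N₀)}`, and each has
dimension `p²k(k+1)/2`, half of `dim 𝒢_{n,p}(𝕂)`: they are two transverse Lagrangian
subalgebras. -/
theorem stmt17 (𝕂 : Type) [RCLike 𝕂] (p k n : ℕ) (hp : 1 ≤ p) (hk : 1 ≤ k)
    (hn : n = k * p) :
    let ω : GA 𝕂 n p → GA 𝕂 n p → 𝕂 := fun a b =>
      -(trace ((bkt a b).1 * H0 𝕂 n p) + trace (N0 𝕂 n p * (bkt a b).2))
    -- L and L' are Lie subalgebras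
    (∀ a ∈ Ltri 𝕂 n p, ∀ b ∈ Ltri 𝕂 n p, bkt a b ∈ Ltri 𝕂 n p) ∧
    (∀ a ∈ Ltri' 𝕂 n p, ∀ b ∈ Ltri' 𝕂 n p, bkt a b ∈ Ltri' 𝕂 n p) ∧
    -- 𝒢 = L ⊕ L' as vector spaces
    Ltri 𝕂 n p ⊓ Ltri' 𝕂 n p = ⊥ ∧ Ltri 𝕂 n p ⊔ Ltri' 𝕂 n p = ⊤ ∧
    -- L and L' are totally isotropic for ω
    (∀ a ∈ Ltri 𝕂 n p, ∀ b ∈ Ltri 𝕂 n p, ω a b = 0) ∧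
    (∀ a ∈ Ltri' 𝕂 n p, ∀ b ∈ Ltri' 𝕂 n p, ω a b = 0) ∧
    -- each of dimension p²k(k+1)/2, half the dimension of 𝒢_{n,p}(𝕂)
    Module.finrank 𝕂 (Ltri 𝕂 n p) = p ^ 2 * k * (k + 1) / 2 ∧
    Module.finrank 𝕂 (Ltri' 𝕂 n p) = p ^ 2 * k * (k + 1) / 2 ∧
    2 * Module.finrank 𝕂 (Ltri 𝕂 n p) = Module.finrank 𝕂 (GA 𝕂 n p) ∧
    2 * Module.finrank 𝕂 (Ltri' 𝕂 n p) = Module.finrank 𝕂 (GA 𝕂 n p) := by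
  intro ω
  have hinf : Ltri 𝕂 n p ⊓ Ltri' 𝕂 n p = ⊥ := by
    rw [eq_bot_iff]
    rintro a ⟨ha, hb⟩
    rw [Submodule.mem_bot]
    refine Prod.ext hb.1 ?_
    ext i j
    rcases le_or_gt ((j : ℕ) / p) ((i : ℕ) / p) with h | h
    · exact ha i j h
    · exact hb.2 i j h
  have hsup : Ltri 𝕂 n p ⊔ Ltri' 𝕂 n p = ⊤ := by
    rw [eq_top_iff]
    rintro a -
    rw [Submodule.mem_sup]
    refine ⟨(a.1, Matrix.of fun i j => if (j : ℕ) / p ≤ (i : ℕ) / p then 0 else a.2 i j),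
      ?_, (0, Matrix.of fun i j => if (j : ℕ) / p ≤ (i : ℕ) / p then a.2 i j else 0), ?_, ?_⟩
    · intro i j hij
      simp [hij]
    · refine ⟨rfl, fun i j hij => ?_⟩
      simp [hij]
    · refine Prod.ext (by simp) ?_
      ext i j
      simp only [Prod.snd_add, Matrix.add_apply, Matrix.of_apply]
      split_ifs <;> simp
  have heq := le_antisymm (le1 𝕂 p k n hp hn) (le2 𝕂 p k n hp hn)
  have hdim := Submodule.finrank_sup_add_finrank_inf_eq (Ltri 𝕂 n p) (Ltri' 𝕂 n p)
  rw [hinf, hsup, finrank_bot, finrank_top] at hdim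
  have htot : Module.finrank 𝕂 (GA 𝕂 n p) = p ^ 2 * k * (k + 1) := by
    rw [Module.finrank_prod, Module.finrank_matrix, Module.finrank_matrix]
    simp only [Fintype.card_fin, Module.finrank_self]
    rw [hn]; ring
  refine ⟨?_, ?_, hinf, hsup, ?_, ?_, by omega, by omega, by omega, by omega⟩
  · intro a ha b hb i j hij
    simp only [bkt, Matrix.sub_apply]
    rw [Ltri_mul_aux ha hb i j (by omega), Ltri_mul_aux hb ha i j (by omega), sub_zero]
  · intro a ha b hb
    refine ⟨?_, fun i j hij => ?_⟩
    · simp [bkt, ha.1, hb.1]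
    · simp only [bkt, Matrix.sub_apply]
      rw [Ltri_mul_aux' ha hb i j hij, Ltri_mul_aux' hb ha i j hij, sub_zero]
  · intro a ha b hb
    simp only [ω, bkt]
    rw [trN hp, Matrix.sub_mul, Matrix.trace_sub, trH hp hk hn ha, trH hp hk hn hb]
    · simp
    · intro i j hij
      rw [Matrix.sub_apply, Ltri_mul_aux ha hb i j hij.le, Ltri_mul_aux hb ha i j hij.le, sub_zero]
  · intro a ha b hb
    simp only [ω, bkt]
    rw [trN hp, ha.1, hb.1]
    · simp
    · intro i j hij
      rw [Matrix.sub_apply, Ltri_mul_aux' ha hb i j (by omega), Ltri_mul_aux' hb ha i j (by omega), sub_zero]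
end
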